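/- Let m ≥ 2 and let N be a vector field smooth on a neighborhood of the closed unit ball B̄ ⊂ ℝ^m with div N = 0 on B̄ and ∑_k N_k(x) x_k = 0 for all x ∈ S. Then there exist vector fields P and Q, smooth on B̄, with N = P + Q on B̄, uniquely determined by the following conditions: (for P) div P = 0 on B̄, ∑_k P_k(x) x_k = 0 for x ∈ S, and ∑_{k,l}(∂_k P_l − ∂_l P_k)(x) x_k v_l = 0 for every x ∈ S and every v with ⟨v,x⟩ = 0; (for Q) div Q = 0 on B̄, ∑_k Q_k(x) x_k = 0 for x ∈ S, and the componentwise vector Laplacian of Q is curl-free: ∂_j(ΔQ_k)(x) = ∂_k(ΔQ_j)(x) for all x ∈ B̄ and all j, k. (This is the paper's Theorem 5.1 decomposing a divergence-free one-form with vanishing normal part, specialized to the flat ball; for a divergence-free Q the condition d d† d Q = 0 is exactly the curl-freeness of ΔQ.) -/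

import Mathlib

/-!
STATEMENT 3: The paper's Theorem 5.1: a divergence-free vector field on the
closed unit ball with vanishing normal part on the boundary decomposes uniquely
as N = P + Q, where P additionally satisfies the boundary condition 𝐧 dP = 0
and Q has curl-free componentwise Laplacian (d d† d Q = 0).
-/

noncomputable section

/-- Euclidean space ℝ^m. -/
abbrev E (m : ℕ) := EuclideanSpace ℝ (Fin m)

/-- The closed unit ball B̄ ⊆ ℝ^m. -/
def Ball (m : ℕ) : Set (E m) := Metric.closedBall 0 1

/-- The unit sphere S = ∂B̄ ⊆ ℝ^m. -/
def Sph (m : ℕ) : Set (E m) := Metric.sphere 0 1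

/-- The i-th partial derivative (taken within the closed unit ball). -/
def pd {m : ℕ} (i : Fin m) (f : E m → ℝ) : E m → ℝ :=
  fun x => fderivWithin ℝ f (Ball m) x (EuclideanSpace.single i 1)

/-- The Euclidean Laplacian Δf = ∑ i, ∂_i ∂_i f. -/
def lap {m : ℕ} (f : E m → ℝ) : E m → ℝ :=
  fun x => ∑ i, pd i (pd i f) x

/-- Side conditions characterizing the `nd`-part `P`:
divergence free on B̄, tangential on S, and 𝐧 dP = 0 on S. -/
def IsNdPart {m : ℕ} (P : Fin m → E m → ℝ) : Prop :=
  (∀ i, ContDiffOn ℝ (⊤ : ℕ∞) (P i) (Ball m)) ∧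
  (∀ x ∈ Ball m, ∑ i, pd i (P i) x = 0) ∧
  (∀ x ∈ Sph m, ∑ k, P k x * x k = 0) ∧
  (∀ x ∈ Sph m, ∀ v : E m, (∑ k, v k * x k) = 0 →
    ∑ k, ∑ l, (pd k (P l) x - pd l (P k) x) * x k * v l = 0)

/-- Side conditions characterizing the remaining part `Q`:
divergence free on B̄, tangential on S, and with curl-free componentwise
Laplacian (which, for divergence-free Q, is the condition d d† d Q = 0). -/
def IsBarPart {m : ℕ} (Q : Fin m → E m → ℝ) : Prop :=
  (∀ i, ContDiffOn ℝ (⊤ : ℕ∞) (Q i) (Ball m)) ∧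
  (∀ x ∈ Ball m, ∑ i, pd i (Q i) x = 0) ∧
  (∀ x ∈ Sph m, ∑ k, Q k x * x k = 0) ∧
  (∀ x ∈ Ball m, ∀ j k, pd j (lap (Q k)) x = pd k (lap (Q j)) x)

section
open MvPolynomial

/-- Polynomials in `m` variables. -/
abbrev Pol (m : ℕ) := MvPolynomial (Fin m) ℝ

namespace Pol
variable {m : ℕ}

/-- Euler derivation. -/
def eu : Derivation ℝ (Pol m) (Pol m) := ∑ i, (X i : Pol m) • pderiv i

/-- Rotation derivation. -/
def rot (i j : Fin m) : Derivation ℝ (Pol m) (Pol m) :=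
  (X i : Pol m) • pderiv j - (X j : Pol m) • pderiv i

/-- Laplacian on polynomials. -/
def lp : Pol m →ₗ[ℝ] Pol m := ∑ i, (pderiv i).toLinearMap ∘ₗ (pderiv i).toLinearMap

/-- The polynomial `|x|^2 - 1`. -/
def sq : Pol m := ∑ i, X i * X i - 1

theorem derivation_sum_apply {ι : Type*} (s : Finset ι) (D : ι → Derivation ℝ (Pol m) (Pol m)) (p : Pol m) :
    (∑ i ∈ s, D i) p = ∑ i ∈ s, D i p := by
  classical
  induction s using Finset.induction_on with
  | empty => simp
  | insert a s ha ih => rw [Finset.sum_insert ha, Finset.sum_insert ha, Derivation.add_apply, ih]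

theorem eu_apply (p : Pol m) : eu p = ∑ i, X i * pderiv i p := by
  simp [eu, derivation_sum_apply]

theorem rot_apply (i j : Fin m) (p : Pol m) : rot i j p = X i * pderiv j p - X j * pderiv i p := by
  simp [rot]

theorem lp_apply (p : Pol m) : lp p = ∑ i, pderiv i (pderiv i p) := by
  simp [lp]

theorem eu_X (i : Fin m) : eu (X i : Pol m) = X i := by
  classical
  rw [eu_apply]
  simp [pderiv_X, Pi.single_apply]

theorem d_comm (i j : Fin m) (p : Pol m) : pderiv i (pderiv j p) = pderiv j (pderiv i p) := by
  classical
  have : ⁅(pderiv i : Derivation ℝ (Pol m) (Pol m)), (pderiv j : Derivation ℝ (Pol m) (Pol m))⁆ = 0 := by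
    apply derivation_ext
    intro k
    simp only [Derivation.commutator_apply, pderiv_X, Pi.single_apply, Derivation.zero_apply]
    split_ifs <;> simp
  have h := congrArg (fun D => D p) this
  simp only [Derivation.commutator_apply, Derivation.zero_apply] at h
  exact sub_eq_zero.1 h

theorem d_eu (i : Fin m) (p : Pol m) : pderiv i (eu p) = eu (pderiv i p) + pderiv i p := by
  classical
  have : ⁅(pderiv i : Derivation ℝ (Pol m) (Pol m)), eu⁆ = pderiv i := by
    apply derivation_ext
    intro k
    simp only [Derivation.commutator_apply, eu_X, pderiv_X, Pi.single_apply]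
    split_ifs <;> simp
  have h := congrArg (fun D => D p) this
  simp only [Derivation.commutator_apply] at h
  rw [← sub_eq_iff_eq_add', ]; exact h

theorem d_lp (i : Fin m) (p : Pol m) : pderiv i (lp p) = lp (pderiv i p) := by
  simp only [lp_apply, map_sum]
  refine Finset.sum_congr rfl fun j _ => ?_
  rw [d_comm i j, d_comm i j]

theorem lp_eu (p : Pol m) : lp (eu p) = eu (lp p) + 2 * lp p := by
  simp only [lp_apply, map_sum, d_eu, map_add, Finset.sum_add_distrib]
  ring

theorem lp_X_mul (i : Fin m) (p : Pol m) : lp (X i * p) = X i * lp p + 2 * pderiv i p := by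
  classical
  simp only [lp_apply]
  have : ∀ j, pderiv j (pderiv j (X i * p)) =
      X i * pderiv j (pderiv j p) + (if j = i then 2 * pderiv i p else 0) := by
    intro j
    simp only [pderiv_mul, pderiv_X, Pi.single_apply, map_add]
    by_cases h : j = i
    · subst h; simp; ring
    · simp [h, Ne.symm h]
  simp only [this, Finset.sum_add_distrib, Finset.mul_sum]
  simp

theorem d_sq (i : Fin m) : pderiv i (sq : Pol m) = 2 * X i := by
  classical
  simp only [sq, map_sub, map_sum, pderiv_mul, pderiv_X, Pi.single_apply, pderiv_one]
  simp [Finset.sum_add_distrib]; ring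

theorem rot_sq (i j : Fin m) : rot i j (sq : Pol m) = 0 := by
  rw [rot_apply, d_sq, d_sq]; ring

theorem rot_d (i j k : Fin m) (p : Pol m) : rot i j (pderiv k p) = pderiv k (rot i j p)
    - (if k = i then pderiv j p else 0) + (if k = j then pderiv i p else 0) := by
  classical
  simp only [rot_apply, map_sub, pderiv_mul, pderiv_X, Pi.single_apply, d_comm k]
  by_cases h : k = i <;> by_cases h' : k = j <;> simp [h, h', eq_comm] <;> grind

theorem lp_sq_mul (p : Pol m) : lp (sq * p) = 4 * eu p + 2 * (m : Pol m) * p + sq * lp p := by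
  have e : (sq : Pol m) * p = ∑ i, X i * (X i * p) - p := by
    simp only [sq, sub_mul, Finset.sum_mul, mul_assoc, one_mul]
  rw [e, map_sub, map_sum]
  have : ∀ i, lp (X i * (X i * p)) = (X i * X i) * lp p + 4 * (X i * pderiv i p) + 2 * p := by
    intro i
    simp only [lp_X_mul, pderiv_mul, pderiv_X_self]; ring
  simp only [this, Finset.sum_add_distrib, ← Finset.mul_sum, ← Finset.sum_mul, ← eu_apply]
  simp [sq]; ring

theorem rot_lp (i j : Fin m) (p : Pol m) : lp (rot i j p) = rot i j (lp p) := by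
  rw [rot_apply, rot_apply, map_sub, lp_X_mul, lp_X_mul, d_lp, d_lp, d_comm]; ring

/-- The angular part identity. -/
theorem sum_rot_rot (p : Pol m) : ∑ i, ∑ j, rot i j (rot i j p) =
    2 * ((sq + 1) * lp p - eu (eu p) - ((m : Pol m) - 2) * eu p) := by
  classical
  have e1 : ∀ i j, rot i j (rot i j p) =
      (X i * pderiv j (X i * pderiv j p) - X i * pderiv j (X j * pderiv i p))
      + (X j * pderiv i (X j * pderiv i p) - X j * pderiv i (X i * pderiv j p)) := by
    intro i j; simp only [rot_apply, map_sub]; ring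
  have e2 : ∑ i, ∑ j, (X j * pderiv i (X j * pderiv i p) - X j * pderiv i (X i * pderiv j p))
     = ∑ i, ∑ j, (X i * pderiv j (X i * pderiv j p) - X i * pderiv j (X j * pderiv i p)) :=
    Finset.sum_comm
  have e3 : ∑ i, ∑ j, (X i * pderiv j (X i * pderiv j p)) = eu p + (sq + 1) * lp p := by
    have : ∀ i j : Fin m, X i * pderiv j (X i * pderiv j p) =
        (if j = i then X i * pderiv i p else 0) + X i * X i * pderiv j (pderiv j p) := by
      intro i j
      simp only [pderiv_mul, pderiv_X, Pi.single_apply]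
      by_cases h : j = i
      · subst h; simp; ring
      · simp [h, Ne.symm h]; ring
    simp only [this, Finset.sum_add_distrib, ← Finset.mul_sum, ← Finset.sum_mul, ← lp_apply]
    simp [eu_apply, sq]
  have e4 : ∑ i, ∑ j, (X i * pderiv j (X j * pderiv i p)) = (m : Pol m) * eu p + (eu (eu p) - eu p) := by
    have : ∀ i, ∑ j, (X i * pderiv j (X j * pderiv i p)) =
        (m : Pol m) * (X i * pderiv i p) + (X i * pderiv i (eu p) - X i * pderiv i p) := by
      intro i
      rw [d_eu, eu_apply]
      simp only [pderiv_mul, pderiv_X_self, mul_add, Finset.sum_add_distrib, Finset.mul_sum]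
      simp
    simp only [this, Finset.sum_add_distrib, Finset.sum_sub_distrib, ← Finset.mul_sum, ← eu_apply]
  simp only [e1, Finset.sum_add_distrib, e2]
  simp only [Finset.sum_sub_distrib, e3, e4]
  ring

theorem sq_d (i : Fin m) (p : Pol m) :
    (sq + 1) * pderiv i p = X i * eu p + ∑ j, X j * rot j i p := by
  simp only [rot_apply, mul_sub, Finset.sum_sub_distrib, eu_apply, Finset.mul_sum, sq]
  simp only [sub_add_cancel, Finset.sum_mul]
  rw [← sub_eq_zero]
  simp only [← Finset.sum_add_distrib, ← Finset.sum_sub_distrib]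
  refine Finset.sum_eq_zero fun j _ => ?_
  ring

end Pol
end

section
open MvPolynomial
namespace Pol
variable {m : ℕ}

theorem eu_monomial (s : Fin m →₀ ℕ) (a : ℝ) :
    eu (monomial s a : Pol m) = (s.degree : ℝ) • monomial s a := by
  rw [eu_apply]
  simp only [X_mul_pderiv_monomial]
  rw [← Finset.sum_smul, ← Nat.cast_smul_eq_nsmul ℝ]
  congr 2
  simp [Finsupp.degree_eq_sum]

theorem coeff_eu (s : Fin m →₀ ℕ) (p : Pol m) : coeff s (eu p) = (s.degree : ℝ) * coeff s p := by
  classical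
  induction p using MvPolynomial.induction_on' with
  | monomial t a =>
    rw [eu_monomial, coeff_smul, coeff_monomial]
    by_cases h : t = s
    · simp [h]
    · simp [h]
  | add p q hp hq => rw [map_add, coeff_add, coeff_add, hp, hq, mul_add]

/-- The inverse of `eu + c`. -/
def tt (c : ℝ) : Pol m →ₗ[ℝ] Pol m :=
  (basisMonomials (Fin m) ℝ).constr ℝ (fun s => ((s.degree : ℝ) + c)⁻¹ • monomial s 1)

theorem tt_monomial (c : ℝ) (s : Fin m →₀ ℕ) (a : ℝ) :
    tt c (monomial s a : Pol m) = ((s.degree : ℝ) + c)⁻¹ • monomial s a := by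
  have h := (basisMonomials (Fin m) ℝ).constr_basis ℝ
    (fun s => ((s.degree : ℝ) + c)⁻¹ • (monomial s 1 : Pol m)) s
  have e : (monomial s a : Pol m) = a • basisMonomials (Fin m) ℝ s := by
    simp [smul_monomial]
  rw [e, map_smul, tt, h]
  simp [smul_monomial, mul_comm]

theorem coeff_tt (c : ℝ) (s : Fin m →₀ ℕ) (p : Pol m) :
    coeff s (tt c p) = ((s.degree : ℝ) + c)⁻¹ * coeff s p := by
  classical
  induction p using MvPolynomial.induction_on' with
  | monomial t a =>
    rw [tt_monomial, coeff_smul, coeff_monomial]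
    by_cases h : t = s
    · simp [h]
    · simp [h]
  | add p q hp hq => rw [map_add, coeff_add, coeff_add, hp, hq, mul_add]

theorem eu_tt {c : ℝ} (hc : 0 < c) (p : Pol m) : eu (tt c p) + c • tt c p = p := by
  ext s
  have : (s.degree : ℝ) + c ≠ 0 := by positivity
  rw [coeff_add, coeff_smul, coeff_eu, coeff_tt]
  simp only [smul_eq_mul]
  field_simp

theorem tt_unique {c : ℝ} (hc : 0 < c) {p u : Pol m} (h : eu u + c • u = p) : u = tt c p := by
  ext s
  have : (s.degree : ℝ) + c ≠ 0 := by positivity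
  rw [coeff_tt, ← h, coeff_add, coeff_smul, coeff_eu]
  simp only [smul_eq_mul]
  field_simp

theorem d_tt {c : ℝ} (hc : 0 < c) (i : Fin m) (p : Pol m) :
    pderiv i (tt c p) = tt (c + 1) (pderiv i p) := by
  apply tt_unique (by linarith)
  conv_rhs => rw [← eu_tt hc p]
  rw [map_add, d_eu, Derivation.map_smul, add_smul, one_smul, add_comm (c • _), add_assoc]

theorem lp_tt {c : ℝ} (hc : 0 < c) (p : Pol m) :
    lp (tt c p) = tt (c + 2) (lp p) := by
  simp only [lp_apply, map_sum]
  refine Finset.sum_congr rfl fun i _ => ?_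
  rw [d_tt hc, d_tt (by linarith), add_assoc]; norm_num

theorem constantCoeff_eu (p : Pol m) : constantCoeff (eu p) = 0 := by
  rw [constantCoeff_eq, coeff_eu]; simp

theorem eq_zero_of_eu {p : Pol m} (h : eu p = 0) (h0 : constantCoeff p = 0) : p = 0 := by
  ext s
  have := coeff_eu s p
  rw [h, coeff_zero] at this
  by_cases hs : s = 0
  · subst hs; simpa [constantCoeff_eq] using h0
  · have : (s.degree : ℝ) ≠ 0 := by
      simpa [Finsupp.degree_eq_zero_iff] using hs
    simp_all

/-- `eu (∑ X l * F l) = ∑ X l * (eu (F l) + F l)`. -/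
theorem eu_dot (F : Fin m → Pol m) : eu (∑ l, X l * F l) = ∑ l, X l * (eu (F l) + F l) := by
  rw [map_sum]
  refine Finset.sum_congr rfl fun l _ => ?_
  rw [Derivation.leibniz, eu_X]; simp only [smul_eq_mul]; ring

theorem lp_dot (F : Fin m → Pol m) :
    lp (∑ l, X l * F l) = ∑ l, X l * lp (F l) + 2 * ∑ l, pderiv l (F l) := by
  rw [map_sum, Finset.mul_sum, ← Finset.sum_add_distrib]
  exact Finset.sum_congr rfl fun l _ => lp_X_mul l _

def bb (H : Fin m → Pol m) : Pol m := (1/2 : ℝ) • tt ((m:ℝ)/2) (∑ l, pderiv l (H l))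
def gG (H : Fin m → Pol m) (l : Fin m) : Pol m := - tt 1 (pderiv l (bb H))
def zZ (H : Fin m → Pol m) (l : Fin m) : Pol m := H l + sq * gG H l
def gg (H : Fin m → Pol m) : Pol m :=
  (1/4 : ℝ) • tt ((m:ℝ)/2) ((2:ℝ) • bb H - ∑ l, pderiv l (H l))
def qQ (H : Fin m → Pol m) (l : Fin m) : Pol m := tt 1 (zZ H l + pderiv l (sq * gg H))

section


theorem bb_eq (hm : 0 < m) (H : Fin m → Pol m) : (2:ℝ) • eu (bb H) + (m:ℝ) • bb H = ∑ l, pderiv l (H l) := by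
  have h0 : 0 < (m:ℝ)/2 := by positivity
  have := eu_tt h0 (∑ l, pderiv l (H l))
  rw [bb, Derivation.map_smul, smul_smul, smul_smul]
  conv_rhs => rw [← this]
  congr 1 <;> [skip; congr 1]
  · norm_num
  · ring

theorem lp_div (H : Fin m → Pol m) (hH : ∀ l, lp (H l) = 0) : lp (∑ l, pderiv l (H l)) = 0 := by
  rw [map_sum]; exact Finset.sum_eq_zero fun l _ => by rw [← d_lp, hH, map_zero]

theorem lp_bb (hm : 0 < m) (H : Fin m → Pol m) (hH : ∀ l, lp (H l) = 0) : lp (bb H) = 0 := by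
  have h0 : 0 < (m:ℝ)/2 := by positivity
  rw [bb, map_smul, lp_tt h0, lp_div H hH, map_zero, smul_zero]

theorem lp_gg (hm : 0 < m) (H : Fin m → Pol m) (hH : ∀ l, lp (H l) = 0) : lp (gg H) = 0 := by
  have h0 : 0 < (m:ℝ)/2 := by positivity
  rw [gg, map_smul, lp_tt h0, map_sub, map_smul, lp_div H hH, lp_bb hm H hH]; simp

theorem lp_gG (hm : 0 < m) (H : Fin m → Pol m) (hH : ∀ l, lp (H l) = 0) (l) : lp (gG H l) = 0 := by
  rw [gG, map_neg, lp_tt one_pos, ← d_lp, lp_bb hm H hH]; simp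

theorem cast_mul (p : Pol m) (a : ℕ) : (a : Pol m) * p = (a : ℝ) • p := by
  rw [← nsmul_eq_mul, Nat.cast_smul_eq_nsmul]

theorem two_mul_eq (p : Pol m) : 2 * p = (2 : ℝ) • p := by
  rw [smul_eq_C_mul, map_ofNat]

theorem four_mul_eq (p : Pol m) : 4 * p = (4 : ℝ) • p := by
  rw [smul_eq_C_mul, map_ofNat]

theorem lp_sq_mul' {p : Pol m} (hp : lp p = 0) : lp (sq * p) = (4:ℝ) • eu p + (2 * (m : ℝ)) • p := by
  rw [lp_sq_mul, hp, mul_zero, add_zero, mul_assoc, cast_mul, mul_smul, four_mul_eq, two_mul_eq]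

theorem dot_H (hm : 0 < m) (H W u : Fin m → Pol m) (hH : ∀ l, lp (H l) = 0) (hHW : ∀ l, H l = W l - sq * u l) (hW : ∑ l, X l * W l = 0) (inj : ∀ w : Pol m, lp (sq * w) = 0 → w = 0) : ∑ l, X l * H l = sq * bb H := by
  have e : ∑ l, X l * H l = sq * (- ∑ l, X l * u l) := by
    have e1 : ∀ l, X l * H l = X l * W l - sq * (X l * u l) := by
      intro l; rw [hHW l]; ring
    rw [Finset.sum_congr rfl fun l _ => e1 l, Finset.sum_sub_distrib, hW, ← Finset.mul_sum]
    ring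
  have h1 : lp (sq * (- ∑ l, X l * u l)) = lp (sq * bb H) := by
    rw [← e, lp_dot, lp_sq_mul' (lp_bb hm H hH), ← bb_eq hm H]
    simp only [hH, mul_zero, Finset.sum_const_zero, zero_add]
    rw [two_mul_eq, smul_add, smul_smul, smul_smul]; norm_num
  rw [e]
  have h2 : (- ∑ l, X l * u l) - bb H = 0 := by
    apply inj
    rw [mul_sub, map_sub, h1, sub_self]
  rw [sub_eq_zero.1 h2]

theorem bb_zero (hm : 0 < m) (H W u : Fin m → Pol m) (hH : ∀ l, lp (H l) = 0) (hHW : ∀ l, H l = W l - sq * u l) (hW : ∑ l, X l * W l = 0) (inj : ∀ w : Pol m, lp (sq * w) = 0 → w = 0) : constantCoeff (bb H) = 0 := by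
  have := congrArg constantCoeff (dot_H hm H W u hH hHW hW inj)
  simpa [sq] using this

theorem dot_gG (hm : 0 < m) (H W u : Fin m → Pol m) (hH : ∀ l, lp (H l) = 0) (hHW : ∀ l, H l = W l - sq * u l) (hW : ∑ l, X l * W l = 0) (inj : ∀ w : Pol m, lp (sq * w) = 0 → w = 0) : ∑ l, X l * gG H l = - bb H := by
  rw [← sub_eq_zero, sub_neg_eq_add]
  apply eq_zero_of_eu
  · rw [map_add, eu_dot]
    have : ∀ l, eu (gG H l) + gG H l = - pderiv l (bb H) := by
      intro l
      rw [gG, map_neg, ← neg_add]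
      congr 1
      simpa using eu_tt one_pos (pderiv l (bb H))
    rw [Finset.sum_congr rfl fun l _ => by rw [this l], eu_apply]
    simp
  · simp [bb_zero hm H W u hH hHW hW inj]

theorem dot_zZ (hm : 0 < m) (H W u : Fin m → Pol m) (hH : ∀ l, lp (H l) = 0) (hHW : ∀ l, H l = W l - sq * u l) (hW : ∑ l, X l * W l = 0) (inj : ∀ w : Pol m, lp (sq * w) = 0 → w = 0) : ∑ l, X l * zZ H l = 0 := by
  have : ∀ l, X l * zZ H l = X l * H l + sq * (X l * gG H l) := by
    intro l; rw [zZ]; ring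
  simp only [this, Finset.sum_add_distrib, ← Finset.mul_sum, dot_H hm H W u hH hHW hW inj, dot_gG hm H W u hH hHW hW inj]
  ring

theorem d_gG (H : Fin m → Pol m) (j k : Fin m) : pderiv j (gG H k) = pderiv k (gG H j) := by
  rw [gG, gG, map_neg, map_neg, d_tt one_pos, d_tt one_pos, d_comm]

theorem div_gG (hm : 0 < m) (H : Fin m → Pol m) (hH : ∀ l, lp (H l) = 0) : ∑ l, pderiv l (gG H l) = 0 := by
  have : ∑ l, pderiv l (gG H l) = - tt (1+1) (lp (bb H)) := by
    simp only [gG, map_neg, d_tt one_pos, lp_apply, map_sum, Finset.sum_neg_distrib]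
  rw [this, lp_bb hm H hH]; simp

theorem div_zZ (hm : 0 < m) (H W u : Fin m → Pol m) (hH : ∀ l, lp (H l) = 0) (hHW : ∀ l, H l = W l - sq * u l) (hW : ∑ l, X l * W l = 0) (inj : ∀ w : Pol m, lp (sq * w) = 0 → w = 0) : ∑ l, pderiv l (zZ H l) = ∑ l, pderiv l (H l) - (2:ℝ) • bb H := by
  have : ∀ l, pderiv l (zZ H l) = pderiv l (H l) + (2 * (X l * gG H l) + sq * pderiv l (gG H l)) := by
    intro l; rw [zZ, map_add, pderiv_mul, d_sq]; ring
  simp only [this, Finset.sum_add_distrib, ← Finset.mul_sum, div_gG hm H hH, dot_gG hm H W u hH hHW hW inj]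
  rw [← two_mul_eq]; ring

theorem lp_q (hm : 0 < m) (H : Fin m → Pol m) (hH : ∀ l, lp (H l) = 0) : lp (sq * gg H) = (2:ℝ) • bb H - ∑ l, pderiv l (H l) := by
  have h0 : 0 < (m:ℝ)/2 := by positivity
  have := eu_tt h0 ((2:ℝ) • bb H - ∑ l, pderiv l (H l))
  rw [lp_sq_mul' (lp_gg hm H hH)]
  conv_rhs => rw [← this]
  rw [gg, Derivation.map_smul, smul_smul, smul_smul]
  congr 1 <;> [skip; congr 1]
  · norm_num
  · ring

theorem gg_zero (hm : 0 < m) (H W u : Fin m → Pol m) (hH : ∀ l, lp (H l) = 0) (hHW : ∀ l, H l = W l - sq * u l) (hW : ∑ l, X l * W l = 0) (inj : ∀ w : Pol m, lp (sq * w) = 0 → w = 0) : constantCoeff (gg H) = 0 := by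
  have h1 := bb_zero hm H W u hH hHW hW inj
  have h2 := congrArg constantCoeff (bb_eq hm H)
  simp only [map_add, smul_eq_C_mul, map_mul, constantCoeff_C, constantCoeff_eu, h1] at h2
  rw [gg, smul_eq_C_mul, map_mul, constantCoeff_C, constantCoeff_eq, coeff_tt, ← constantCoeff_eq, map_sub, ← h2, smul_eq_C_mul, map_mul, h1]
  simp

theorem qQ_eq (H : Fin m → Pol m) (l) : eu (qQ H l) + qQ H l = zZ H l + pderiv l (sq * gg H) := by
  have := eu_tt one_pos (zZ H l + pderiv l (sq * gg H))
  rwa [one_smul] at this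

theorem div_qQ (hm : 0 < m) (H W u : Fin m → Pol m) (hH : ∀ l, lp (H l) = 0) (hHW : ∀ l, H l = W l - sq * u l) (hW : ∑ l, X l * W l = 0) (inj : ∀ w : Pol m, lp (sq * w) = 0 → w = 0) : ∑ l, pderiv l (qQ H l) = 0 := by
  have : ∑ l, pderiv l (qQ H l) = tt (1+1) (∑ l, pderiv l (zZ H l) + lp (sq * gg H)) := by
    simp only [qQ, d_tt one_pos, lp_apply, ← Finset.sum_add_distrib, map_add, map_sum]
  rw [this, lp_q hm H hH, div_zZ hm H W u hH hHW hW inj]; simp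

theorem dot_qQ (hm : 0 < m) (H W u : Fin m → Pol m) (hH : ∀ l, lp (H l) = 0) (hHW : ∀ l, H l = W l - sq * u l) (hW : ∑ l, X l * W l = 0) (inj : ∀ w : Pol m, lp (sq * w) = 0 → w = 0) : ∑ l, X l * qQ H l = sq * gg H := by
  rw [← sub_eq_zero]
  apply eq_zero_of_eu
  · rw [map_sub, eu_dot]
    simp only [qQ_eq, mul_add, Finset.sum_add_distrib, ← eu_apply, dot_zZ hm H W u hH hHW hW inj]
    simp
  · simp [gg_zero hm H W u hH hHW hW inj]

theorem curl_qQ (hm : 0 < m) (H W u : Fin m → Pol m) (hH : ∀ l, lp (H l) = 0) (hHW : ∀ l, H l = W l - sq * u l) (hW : ∑ l, X l * W l = 0) (inj : ∀ w : Pol m, lp (sq * w) = 0 → w = 0) (l) : ∑ k, (pderiv k (qQ H l) - pderiv l (qQ H k)) * X k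
    = W l + sq * (gG H l - u l) := by
  classical
  have h1 := dot_qQ hm H W u hH hHW hW inj
  have h2 := congrArg (pderiv l) h1
  have h3 := qQ_eq H l
  have h4 : pderiv l (∑ k, X k * qQ H k) = qQ H l + ∑ k, X k * pderiv l (qQ H k) := by
    simp only [map_sum, pderiv_mul, pderiv_X, Pi.single_apply, Finset.sum_add_distrib]
    simp
  have h5 : ∑ k, (pderiv k (qQ H l) - pderiv l (qQ H k)) * X k
    = eu (qQ H l) - ∑ k, X k * pderiv l (qQ H k) := by
    rw [eu_apply, ← Finset.sum_sub_distrib]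
    exact Finset.sum_congr rfl fun k _ => by ring
  rw [h5]
  rw [h4] at h2
  have h6 : zZ H l = W l + sq * (gG H l - u l) := by rw [zZ, hHW l]; ring
  rw [← h6]
  linear_combination h3 - h2

theorem lap_qQ (hm : 0 < m) (H : Fin m → Pol m) (hH : ∀ l, lp (H l) = 0) (j k) : pderiv j (lp (qQ H k)) = pderiv k (lp (qQ H j)) := by
  have e : ∀ j k, pderiv j (lp (qQ H k)) =
      tt (1+2+1) ((4:ℝ) • (eu (pderiv j (gG H k)) + pderiv j (gG H k)) + (2*(m:ℝ)) • pderiv j (gG H k) + pderiv j (pderiv k (lp (sq * gg H)))) := by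
    intro j k
    rw [qQ, lp_tt one_pos, d_tt (by norm_num), map_add, ← d_lp, zZ, map_add lp, hH, zero_add,
      lp_sq_mul' (lp_gG hm H hH k)]
    simp only [map_add, Derivation.map_smul, d_eu]
  rw [e, e, d_gG H j k, d_comm j k]

end
end Pol
end

section
open Set Filter Topology

variable {m : ℕ}

/-- Smooth on the closed ball. -/
def Sm (f : E m → ℝ) : Prop := ContDiffOn ℝ (⊤ : ℕ∞) f (Ball m)

theorem ball_nonempty : (Ball m).Nonempty := ⟨0, by simp [Ball]⟩

theorem ball_compact : IsCompact (Ball m) := isCompact_closedBall _ _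

theorem interior_ball : interior (Ball m) = Metric.ball 0 1 := by
  simpa [Ball] using interior_closedBall (0 : E m) one_ne_zero

theorem ball_convex : Convex ℝ (Ball m) := convex_closedBall _ _

theorem ball_uniq : UniqueDiffOn ℝ (Ball m) :=
  uniqueDiffOn_convex ball_convex (by rw [interior_ball]; exact ⟨0, by simp⟩)

theorem sph_sub {x : E m} (hx : x ∈ Sph m) : x ∈ Ball m := Metric.sphere_subset_closedBall hx

theorem ball_cases {x : E m} (hx : x ∈ Ball m) : x ∈ Sph m ∨ x ∈ interior (Ball m) := by
  rw [interior_ball]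
  simp only [Ball, Sph, Metric.mem_closedBall, Metric.mem_sphere, Metric.mem_ball] at *
  rcases hx.lt_or_eq with h | h <;> tauto

theorem Sm.diff {f : E m → ℝ} (hf : Sm f) {x : E m} (hx : x ∈ Ball m) :
    DifferentiableWithinAt ℝ f (Ball m) x :=
  (ContDiffOn.differentiableOn hf (by simp)) x hx

theorem Sm.cont {f : E m → ℝ} (hf : Sm f) : ContinuousOn f (Ball m) := ContDiffOn.continuousOn hf

theorem Sm.pd {f : E m → ℝ} (hf : Sm f) (i : Fin m) : Sm (pd i f) := by
  have : ContDiffOn ℝ (⊤ : ℕ∞) (fderivWithin ℝ f (Ball m)) (Ball m) :=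
    ContDiffOn.fderivWithin hf ball_uniq (by simp)
  exact this.clm_apply contDiffOn_const

theorem Sm.add {f g : E m → ℝ} (hf : Sm f) (hg : Sm g) : Sm (fun x => f x + g x) := ContDiffOn.add hf hg
theorem Sm.sub {f g : E m → ℝ} (hf : Sm f) (hg : Sm g) : Sm (fun x => f x - g x) := ContDiffOn.sub hf hg
theorem Sm.mul {f g : E m → ℝ} (hf : Sm f) (hg : Sm g) : Sm (fun x => f x * g x) := ContDiffOn.mul hf hg
theorem Sm.const (c : ℝ) : Sm (fun _ : E m => c) := contDiffOn_const
theorem Sm.coord (i : Fin m) : Sm (fun x : E m => x i) :=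
  (EuclideanSpace.proj (𝕜 := ℝ) i : E m →L[ℝ] ℝ).contDiff.contDiffOn
theorem Sm.sum {ι : Type*} (s : Finset ι) {f : ι → E m → ℝ} (hf : ∀ i ∈ s, Sm (f i)) :
    Sm (fun x => ∑ i ∈ s, f i x) := ContDiffOn.sum hf
theorem Sm.lap {f : E m → ℝ} (hf : Sm f) : Sm (lap f) := Sm.sum _ fun i _ => (hf.pd i).pd i
theorem Sm.congr {f g : E m → ℝ} (hf : Sm f) (h : ∀ x ∈ Ball m, g x = f x) : Sm g := ContDiffOn.congr hf h

theorem pd_add {f g : E m → ℝ} (hf : Sm f) (hg : Sm g) (i : Fin m) {x : E m} (hx : x ∈ Ball m) :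
    pd i (fun x => f x + g x) x = pd i f x + pd i g x := by
  simp only [pd]; rw [fderivWithin_fun_add (ball_uniq x hx) (hf.diff hx) (hg.diff hx)]; rfl

theorem pd_sub {f g : E m → ℝ} (hf : Sm f) (hg : Sm g) (i : Fin m) {x : E m} (hx : x ∈ Ball m) :
    pd i (fun x => f x - g x) x = pd i f x - pd i g x := by
  simp only [pd]; rw [fderivWithin_fun_sub (ball_uniq x hx) (hf.diff hx) (hg.diff hx)]; rfl

theorem pd_mul {f g : E m → ℝ} (hf : Sm f) (hg : Sm g) (i : Fin m) {x : E m} (hx : x ∈ Ball m) :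
    pd i (fun x => f x * g x) x = pd i f x * g x + f x * pd i g x := by
  simp only [pd]; rw [fderivWithin_fun_mul (ball_uniq x hx) (hf.diff hx) (hg.diff hx)]
  simp; ring

theorem pd_const (c : ℝ) (i : Fin m) (x : E m) : pd i (fun _ => c) x = 0 := by
  simp [pd]

theorem pd_coord (i j : Fin m) {x : E m} (hx : x ∈ Ball m) :
    pd i (fun x => x j) x = if i = j then 1 else 0 := by
  have : HasFDerivWithinAt (fun x : E m => x j) (EuclideanSpace.proj (𝕜 := ℝ) j : E m →L[ℝ] ℝ) (Ball m) x :=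
    (EuclideanSpace.proj (𝕜 := ℝ) j : E m →L[ℝ] ℝ).hasFDerivWithinAt
  rw [pd, this.fderivWithin (ball_uniq x hx)]
  simp [eq_comm]

theorem pd_sum {ι : Type*} (s : Finset ι) {f : ι → E m → ℝ} (hf : ∀ i ∈ s, Sm (f i)) (i : Fin m)
    {x : E m} (hx : x ∈ Ball m) :
    pd i (fun x => ∑ j ∈ s, f j x) x = ∑ j ∈ s, pd i (f j) x := by
  simp only [pd]; rw [fderivWithin_fun_sum (ball_uniq x hx) (fun j hj => (hf j hj).diff hx)]; simp

theorem pd_congr {f g : E m → ℝ} (h : ∀ x ∈ Ball m, f x = g x) (i : Fin m)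
    {x : E m} (hx : x ∈ Ball m) : pd i f x = pd i g x := by
  simp only [pd]; rw [fderivWithin_congr h (h x hx)]

theorem lap_congr {f g : E m → ℝ} (h : ∀ x ∈ Ball m, f x = g x)
    {x : E m} (hx : x ∈ Ball m) : lap f x = lap g x := by
  simp only [lap]
  exact Finset.sum_congr rfl fun i _ => pd_congr (fun y hy => pd_congr h i hy) i hx

theorem pd_comm {f : E m → ℝ} (hf : Sm f) (i j : Fin m) {x : E m} (hx : x ∈ Ball m) :
    pd i (pd j f) x = pd j (pd i f) x := by
  have hs : IsSymmSndFDerivWithinAt ℝ f (Ball m) x := by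
    apply ContDiffWithinAt.isSymmSndFDerivWithinAt (n := (⊤ : ℕ∞)) (hf x hx) (by simp; exact WithTop.coe_le_coe.2 (le_top : (2:ℕ∞) ≤ ⊤)) ball_uniq _ hx
    have := ball_convex.closure_interior_eq_closure_of_nonempty_interior (s := Ball m) (by rw [interior_ball]; exact ⟨0, by simp⟩)
    rw [this]; exact subset_closure hx
  have hd : DifferentiableWithinAt ℝ (fderivWithin ℝ f (Ball m)) (Ball m) x := by
    have : ContDiffOn ℝ (⊤ : ℕ∞) (fderivWithin ℝ f (Ball m)) (Ball m) :=
      ContDiffOn.fderivWithin hf ball_uniq (by simp)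
    exact (this.differentiableOn (by simp)) x hx
  have key : ∀ i j, pd i (pd j f) x =
      fderivWithin ℝ (fderivWithin ℝ f (Ball m)) (Ball m) x (EuclideanSpace.single i 1) (EuclideanSpace.single j 1) := by
    intro i j
    change fderivWithin ℝ (fun y => fderivWithin ℝ f (Ball m) y (EuclideanSpace.single j 1)) (Ball m) x _ = _
    rw [fderivWithin_clm_apply (ball_uniq x hx) hd (differentiableWithinAt_const _)]
    simp
  rw [key, key]
  exact hs _ _

/-- expansion of the derivative in coordinates -/
theorem fderiv_eq_sum (f : E m → ℝ) (x v : E m) :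
    fderivWithin ℝ f (Ball m) x v = ∑ i, v i * pd i f x := by
  have : v = ∑ i, v i • EuclideanSpace.single i (1:ℝ) := by
    ext j
    simp [Pi.single_apply]
  conv_lhs => rw [this]
  simp [pd]

theorem euler_max {u : E m → ℝ} (hu : Sm u) {c M : ℝ} (hc : 0 < c)
    (h : ∀ x ∈ Ball m, ∑ i, x i * pd i u x + c * u x ≤ M) : ∀ x ∈ Ball m, c * u x ≤ M := by
  obtain ⟨x0, hx0, hmax⟩ := ball_compact.exists_isMaxOn ball_nonempty hu.cont
  intro x hx
  have h1 : u x ≤ u x0 := hmax hx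
  have h2 := (hmax.localize).hasFDerivWithinAt_nonpos (hu.diff hx0).hasFDerivWithinAt
    (y := (0:E m) - x0) (sub_mem_posTangentConeAt_of_segment_subset
      (ball_convex.segment_subset hx0 (by simp [Ball])))
  rw [zero_sub, map_neg, fderiv_eq_sum] at h2
  have h3 := h x0 hx0
  nlinarith

theorem hasDerivAt_line {f : E m → ℝ} (hf : Sm f) (i : Fin m) {x : E m} (hx : x ∈ interior (Ball m)) (t : ℝ)
    (ht : x + t • EuclideanSpace.single i (1:ℝ) ∈ interior (Ball m)) :
    HasDerivAt (fun t : ℝ => f (x + t • EuclideanSpace.single i (1:ℝ)))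
      (pd i f (x + t • EuclideanSpace.single i (1:ℝ))) t := by
  have h1 : HasFDerivAt f (fderivWithin ℝ f (Ball m) (x + t • EuclideanSpace.single i (1:ℝ)))
     (x + t • EuclideanSpace.single i (1:ℝ)) :=
    (hf.diff (interior_subset ht)).hasFDerivWithinAt.hasFDerivAt (mem_interior_iff_mem_nhds.1 ht)
  have h2 : HasDerivAt (fun t : ℝ => x + t • EuclideanSpace.single i (1:ℝ)) (EuclideanSpace.single i (1:ℝ)) t := by
    simpa using ((hasDerivAt_id t).smul_const (EuclideanSpace.single i (1:ℝ))).const_add x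
  exact h1.comp_hasDerivAt t h2

theorem second_deriv_max {f : ℝ → ℝ} (h : IsLocalMax f 0) (hc : ContinuousAt f 0) : deriv (deriv f) 0 ≤ 0 := by
  by_contra! hlt
  have h1 := isLocalMin_of_deriv_deriv_pos hlt h.deriv_eq_zero hc
  have h2 : f =ᶠ[𝓝 0] fun _ => f 0 := by
    filter_upwards [h, h1] with t h3 h4 using le_antisymm h3 h4
  have h3 : deriv f =ᶠ[𝓝 0] deriv (fun _ => f 0) := h2.deriv
  have := h3.deriv_eq
  simp at this
  linarith

theorem interior_max {v : E m → ℝ} (hv : Sm v) {x : E m} (hx : x ∈ interior (Ball m))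
    (hmax : IsMaxOn v (Ball m) x) (i : Fin m) : pd i (pd i v) x ≤ 0 := by
  set e := EuclideanSpace.single i (1:ℝ) with he
  set l : ℝ → E m := fun t => x + t • e with hl
  have hl0 : l 0 = x := by simp [hl]
  have hlc : Continuous l := by fun_prop
  have hev : ∀ᶠ t in 𝓝 (0:ℝ), l t ∈ interior (Ball m) :=
    hlc.continuousAt.eventually_mem (by rw [hl0]; exact isOpen_interior.mem_nhds hx)
  have h1 : IsLocalMax (fun t => v (l t)) 0 := by
    filter_upwards [hev] with t ht
    rw [hl0]
    exact hmax (interior_subset ht)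
  have hx' : x + (0:ℝ) • e ∈ interior (Ball m) := by simpa using hx
  have hd := hasDerivAt_line hv i hx 0 hx'
  have h2 := second_deriv_max h1 hd.continuousAt
  have h3 : deriv (fun t => v (l t)) =ᶠ[𝓝 0] fun t => pd i v (l t) := by
    filter_upwards [hev] with t ht
    exact (hasDerivAt_line hv i hx t ht).deriv
  rw [h3.deriv_eq, (hasDerivAt_line (hv.pd i) i hx 0 hx').deriv] at h2
  simpa using h2

theorem norm_sq_eq (x : E m) : ‖x‖ ^ 2 = ∑ j, x j * x j := by
  rw [EuclideanSpace.norm_sq_eq]; simp [sq]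

theorem sum_sq_le {x : E m} (hx : x ∈ Ball m) : ∑ j, x j * x j ≤ 1 := by
  have : ‖x‖ ≤ 1 := by simpa [Ball] using hx
  rw [← norm_sq_eq]
  nlinarith [norm_nonneg x]

theorem sum_sq_eq {x : E m} (hx : x ∈ Sph m) : ∑ j, x j * x j = 1 := by
  have : ‖x‖ = 1 := by simpa [Sph] using hx
  rw [← norm_sq_eq, this]; norm_num

theorem pd_normsq (i : Fin m) {x : E m} (hx : x ∈ Ball m) :
    pd i (fun x => ∑ j, x j * x j) x = 2 * x i := by
  rw [pd_sum _ (fun j _ => (Sm.coord j).mul (Sm.coord j)) i hx]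
  simp only [pd_mul (Sm.coord _) (Sm.coord _) i hx, pd_coord _ _ hx]
  simp [Finset.sum_add_distrib]; ring

theorem max_principle (hm : 0 < m) {u : E m → ℝ} (hu : Sm u) {M : ℝ} (hl : ∀ x ∈ Ball m, lap u x = 0)
    (hS : ∀ x ∈ Sph m, u x ≤ M) : ∀ x ∈ Ball m, u x ≤ M := by
  intro x hx
  refine le_of_forall_pos_le_add fun ε hε => ?_
  have hN : Sm (fun x : E m => ∑ j, x j * x j) := Sm.sum _ (fun j _ => (Sm.coord j).mul (Sm.coord j))
  set v : E m → ℝ := fun x => u x + ε * ∑ j, x j * x j with hv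
  have hvs : Sm v := hu.add ((Sm.const ε).mul hN)
  obtain ⟨x0, hx0, hmax⟩ := ball_compact.exists_isMaxOn ball_nonempty hvs.cont
  have h1 : u x ≤ v x := by
    have : 0 ≤ ∑ j, x j * x j := Finset.sum_nonneg fun j _ => mul_self_nonneg _
    simp only [hv]; nlinarith
  have h2 : v x ≤ v x0 := hmax hx
  rcases ball_cases hx0 with hs | hi
  · have : v x0 ≤ M + ε := by
      simp only [hv, sum_sq_eq hs]; linarith [hS x0 hs]
    linarith
  · exfalso
    have h3 : ∀ i, ∀ x ∈ Ball m, pd i v x = pd i u x + ε * (2 * x i) := by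
      intro i x hx
      rw [hv, pd_add hu ((Sm.const ε).mul hN) i hx, pd_mul (Sm.const ε) hN i hx, pd_const, pd_normsq i hx]
      ring
    have h4 : ∀ i, pd i (pd i v) x0 = pd i (pd i u) x0 + 2 * ε := by
      intro i
      rw [pd_congr (h3 i) i hx0, pd_add (hu.pd i) ((Sm.const ε).mul ((Sm.const 2).mul (Sm.coord i))) i hx0,
        pd_mul (Sm.const ε) ((Sm.const 2).mul (Sm.coord i)) i hx0, pd_mul (Sm.const 2) (Sm.coord i) i hx0,
        pd_const, pd_const, pd_coord _ _ hx0]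
      simp; ring
    have h5 : ∑ i, pd i (pd i v) x0 ≤ 0 := Finset.sum_nonpos fun i _ => interior_max hvs hi hmax i
    simp only [h4, Finset.sum_add_distrib] at h5
    have h6 := hl x0 hx0
    simp only [lap] at h6
    rw [h6] at h5
    simp at h5
    have : (0:ℝ) < m := by exact_mod_cast hm
    nlinarith [mul_pos this hε]

theorem max_principle_abs (hm : 0 < m) {u : E m → ℝ} (hu : Sm u) {M : ℝ} (hl : ∀ x ∈ Ball m, lap u x = 0)
    (hS : ∀ x ∈ Sph m, |u x| ≤ M) : ∀ x ∈ Ball m, |u x| ≤ M := by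
  intro x hx
  rw [abs_le]
  refine ⟨?_, max_principle hm hu hl (fun y hy => (abs_le.1 (hS y hy)).2) x hx⟩
  have hn : ∀ i {w : E m → ℝ} (_ : Sm w), ∀ x ∈ Ball m, pd i (fun x => 0 - w x) x = 0 - pd i w x := by
    intro i w hw x hx
    rw [pd_sub (Sm.const 0) hw i hx, pd_const]
  have h2 : ∀ x ∈ Ball m, lap (fun x => 0 - u x) x = 0 := by
    intro x hx
    have := hl x hx
    simp only [lap] at this ⊢
    have h3 : ∀ i, pd i (pd i fun x => 0 - u x) x = - pd i (pd i u) x := by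
      intro i
      rw [pd_congr (hn i hu) i hx, hn i (hu.pd i) x hx, zero_sub]
    rw [Finset.sum_congr rfl fun i _ => h3 i, Finset.sum_neg_distrib, this, neg_zero]
  have := max_principle hm ((Sm.const 0).sub hu) h2 (M := M) (fun y hy => by have := (abs_le.1 (hS y hy)).1; simp; linarith) x hx
  simp at this; linarith

theorem harm_zero (hm : 0 < m) {u : E m → ℝ} (hu : Sm u) (hl : ∀ x ∈ Ball m, lap u x = 0)
    (hS : ∀ x ∈ Sph m, u x = 0) : ∀ x ∈ Ball m, u x = 0 := by
  intro x hx
  have := max_principle_abs hm hu (M := 0) hl (fun y hy => by simp [hS y hy]) x hx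
  simpa using this

theorem euler_max_abs {u : E m → ℝ} (hu : Sm u) {c M : ℝ} (hc : 0 < c)
    (h : ∀ x ∈ Ball m, |∑ i, x i * pd i u x + c * u x| ≤ M) : ∀ x ∈ Ball m, c * |u x| ≤ M := by
  intro x hx
  have h1 := euler_max hu hc (fun y hy => (abs_le.1 (h y hy)).2) x hx
  have h2 := euler_max ((Sm.const 0).sub hu) hc (M := M) (fun y hy => by
    have := (abs_le.1 (h y hy)).1
    have e : ∀ i, y i * pd i (fun x => 0 - u x) y = - (y i * pd i u y) := by
      intro i; rw [pd_sub (Sm.const 0) hu i hy, pd_const]; ring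
    simp only [e, Finset.sum_neg_distrib]; linarith) x hx
  rcases abs_cases (u x) with h | h <;> rw [h.1] <;> linarith
end

section
open Set Filter Topology

variable {m : ℕ}

theorem lap_sum {ι : Type*} (s : Finset ι) {f : ι → E m → ℝ} (hf : ∀ i ∈ s, Sm (f i))
    {x : E m} (hx : x ∈ Ball m) :
    lap (fun x => ∑ j ∈ s, f j x) x = ∑ j ∈ s, lap (f j) x := by
  simp only [lap]
  rw [Finset.sum_comm]
  refine Finset.sum_congr rfl fun i _ => ?_
  rw [pd_congr (fun y hy => pd_sum s hf i hy) i hx, pd_sum s (fun j hj => (hf j hj).pd i) i hx]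

theorem lap_sub {f g : E m → ℝ} (hf : Sm f) (hg : Sm g) {x : E m} (hx : x ∈ Ball m) :
    lap (fun x => f x - g x) x = lap f x - lap g x := by
  simp only [lap]
  rw [← Finset.sum_sub_distrib]
  refine Finset.sum_congr rfl fun i _ => ?_
  rw [pd_congr (fun y hy => pd_sub hf hg i hy) i hx, pd_sub (hf.pd i) (hg.pd i) i hx]

theorem pd_coord_mul {f : E m → ℝ} (hf : Sm f) (i k : Fin m) {x : E m} (hx : x ∈ Ball m) :
    pd i (fun x => x k * f x) x = (if i = k then f x else 0) + x k * pd i f x := by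
  rw [pd_mul (Sm.coord k) hf i hx, pd_coord i k hx]; simp

theorem lap_coord_mul {f : E m → ℝ} (hf : Sm f) (k : Fin m) {x : E m} (hx : x ∈ Ball m) :
    lap (fun x => x k * f x) x = x k * lap f x + 2 * pd k f x := by
  simp only [lap]
  have : ∀ i, pd i (pd i fun x => x k * f x) x = x k * pd i (pd i f) x + (if i = k then 2 * pd k f x else 0) := by
    intro i
    rw [pd_congr (fun y hy => pd_coord_mul hf i k hy) i hx]
    by_cases h : i = k
    · subst h
      simp only [if_true]
      rw [pd_add hf ((Sm.coord i).mul (hf.pd i)) i hx, pd_coord_mul (hf.pd i) i i hx]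
      simp; ring
    · simp only [h, if_false]
      rw [pd_add (Sm.const 0) ((Sm.coord k).mul (hf.pd i)) i hx, pd_coord_mul (hf.pd i) i k hx, pd_const]
      simp [h]
  rw [Finset.sum_congr rfl fun i _ => this i, Finset.sum_add_distrib, ← Finset.mul_sum]
  simp

theorem pd_lap {f : E m → ℝ} (hf : Sm f) (i : Fin m) {x : E m} (hx : x ∈ Ball m) :
    pd i (lap f) x = lap (pd i f) x := by
  have : pd i (lap f) x = ∑ j, pd i (pd j (pd j f)) x :=
    pd_sum _ (fun j _ => (hf.pd j).pd j) i hx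
  rw [this]; simp only [lap]
  refine Finset.sum_congr rfl fun j _ => ?_
  rw [pd_comm (hf.pd j) i j hx, pd_congr (fun y hy => pd_comm hf i j hy) j hx]

theorem pd_dot {F : Fin m → E m → ℝ} (hF : ∀ k, Sm (F k)) (i : Fin m) {x : E m} (hx : x ∈ Ball m) :
    pd i (fun x => ∑ k, x k * F k x) x = F i x + ∑ k, x k * pd i (F k) x := by
  rw [pd_sum _ (fun k _ => (Sm.coord k).mul (hF k)) i hx]
  rw [Finset.sum_congr rfl fun k _ => pd_coord_mul (hF k) i k hx, Finset.sum_add_distrib]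
  simp

theorem lap_dot {F : Fin m → E m → ℝ} (hF : ∀ k, Sm (F k)) {x : E m} (hx : x ∈ Ball m) :
    lap (fun x => ∑ k, x k * F k x) x = ∑ k, x k * lap (F k) x + 2 * ∑ k, pd k (F k) x := by
  rw [lap_sum _ (fun k _ => (Sm.coord k).mul (hF k)) hx]
  rw [Finset.sum_congr rfl fun k _ => lap_coord_mul (hF k) k hx, Finset.sum_add_distrib, Finset.mul_sum]

theorem pd_zero_of {f : E m → ℝ} (h : ∀ x ∈ Ball m, f x = 0) (i : Fin m) {x : E m} (hx : x ∈ Ball m) :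
    pd i f x = 0 := by
  rw [pd_congr h i hx, pd_const]

theorem lap_zero_of {f : E m → ℝ} (h : ∀ x ∈ Ball m, f x = 0) {x : E m} (hx : x ∈ Ball m) :
    lap f x = 0 := by
  simp only [lap]
  exact Finset.sum_eq_zero fun i _ => pd_zero_of (fun y hy => pd_zero_of h i hy) i hx

theorem inner_eq (x y : E m) : inner ℝ x y = ∑ i, x i * y i := by
  simp [PiLp.inner_apply, mul_comm]

theorem tang_unit {f : E m → ℝ} (hf : Sm f) (h : ∀ x ∈ Sph m, f x = 0) {x v : E m} (hx : x ∈ Sph m)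
    (hv : ‖v‖ = 1) (hxv : inner ℝ x v = 0) : fderivWithin ℝ f (Ball m) x v = 0 := by
  set c : ℝ → E m := fun t => Real.cos t • x + Real.sin t • v with hc
  have hx1 : ‖x‖ = 1 := by simpa [Sph] using hx
  have hcS : ∀ t, c t ∈ Sph m := by
    intro t
    have : ‖c t‖ ^ 2 = 1 := by
      rw [hc]; simp only
      rw [norm_add_sq_real, norm_smul, norm_smul, inner_smul_left, inner_smul_right, hxv, hv, hx1]
      simp
    simp only [Sph, mem_sphere_iff_norm, sub_zero]
    have h0 := norm_nonneg (c t)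
    nlinarith
  have hd : HasDerivAt c v 0 := by
    have := ((Real.hasDerivAt_cos 0).smul_const x).add ((Real.hasDerivAt_sin 0).smul_const v)
    refine (this.congr_deriv ?_)
    simp
  have hc0 : c 0 = x := by simp [hc]
  have hf' := (hf.diff (sph_sub hx)).hasFDerivWithinAt
  rw [← hc0] at hf'
  have h1 := hf'.comp_hasDerivWithinAt (s := univ) 0 hd.hasDerivWithinAt (fun t _ => sph_sub (hcS t))
  rw [hasDerivWithinAt_univ] at h1
  have h2 : f ∘ c = fun _ => 0 := by ext t; exact h _ (hcS t)
  rw [h2, hc0] at h1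
  exact h1.unique (hasDerivAt_const _ _)

theorem tang {f : E m → ℝ} (hf : Sm f) (h : ∀ x ∈ Sph m, f x = 0) {x v : E m} (hx : x ∈ Sph m)
    (hxv : inner ℝ x v = 0) : fderivWithin ℝ f (Ball m) x v = 0 := by
  by_cases hv : v = 0
  · simp [hv]
  · have hv' : ‖v‖ ≠ 0 := by simpa using hv
    have h1 := tang_unit hf h hx (v := ‖v‖⁻¹ • v) (by rw [norm_smul]; simp [hv']) (by rw [inner_smul_right, hxv, mul_zero])
    rw [map_smul] at h1
    simpa [hv'] using h1

/-- boundary derivative of a function vanishing on the sphere is radial -/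
theorem pd_boundary {f : E m → ℝ} (hf : Sm f) (h : ∀ x ∈ Sph m, f x = 0) {x : E m} (hx : x ∈ Sph m)
    (j : Fin m) : pd j f x = x j * ∑ i, x i * pd i f x := by
  have h1 := tang hf h hx (v := EuclideanSpace.single j 1 - x j • x) (by
    have hx1 : ‖x‖ = 1 := by simpa [Sph] using hx
    rw [inner_sub_right, inner_smul_right, real_inner_self_eq_norm_sq, hx1]
    simp [EuclideanSpace.inner_single_right])
  rw [map_sub, map_smul, fderiv_eq_sum f x x, smul_eq_mul] at h1
  have : pd j f x = fderivWithin ℝ f (Ball m) x (EuclideanSpace.single j 1) := rfl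
  rw [this]; linarith

theorem uniq (hm : 0 < m) {D : Fin m → E m → ℝ} (hD : ∀ i, Sm (D i))
    (hdiv : ∀ x ∈ Ball m, ∑ i, pd i (D i) x = 0)
    (htan : ∀ x ∈ Sph m, ∑ k, D k x * x k = 0)
    (hn : ∀ x ∈ Sph m, ∀ v : E m, (∑ k, v k * x k) = 0 →
      ∑ k, ∑ l, (pd k (D l) x - pd l (D k) x) * x k * v l = 0)
    (hcl : ∀ x ∈ Ball m, ∀ j k, pd j (lap (D k)) x = pd k (lap (D j)) x) :
    ∀ i, ∀ x ∈ Ball m, D i x = 0 := by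
  set F : Fin m → Fin m → E m → ℝ := fun k l x => pd k (D l) x - pd l (D k) x with hF
  have hFs : ∀ k l, Sm (F k l) := fun k l => ((hD l).pd k).sub ((hD k).pd l)
  set Z : Fin m → E m → ℝ := fun l x => ∑ k, x k * F k l x with hZ
  have hZs : ∀ l, Sm (Z l) := fun l => Sm.sum _ fun k _ => (Sm.coord k).mul (hFs k l)
  have hdivD : Sm (fun x => ∑ i, pd i (D i) x) := Sm.sum _ fun i _ => (hD i).pd i
  have hXZ : ∀ x, ∑ l, x l * Z l x = 0 := by
    intro x
    have h1 : ∑ l, x l * Z l x = ∑ l, ∑ k, x l * x k * F k l x := by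
      refine Finset.sum_congr rfl fun l _ => ?_
      rw [hZ]; simp only [Finset.mul_sum]
      exact Finset.sum_congr rfl fun k _ => by ring
    have h2 : ∑ l, ∑ k, x l * x k * F k l x = - ∑ l, ∑ k, x l * x k * F k l x := by
      conv_lhs => rw [Finset.sum_comm]
      simp only [← Finset.sum_neg_distrib]
      refine Finset.sum_congr rfl fun l _ => Finset.sum_congr rfl fun k _ => ?_
      simp only [hF]; ring
    rw [h1]; linarith
  have hZS : ∀ l, ∀ x ∈ Sph m, Z l x = 0 := by
    intro l x hx
    have h1 := hn x hx (WithLp.toLp 2 fun l => Z l x) (by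
      simp only []
      rw [← hXZ x]; exact Finset.sum_congr rfl fun k _ => by ring)
    have h2 : ∑ l, Z l x * Z l x = 0 := by
      rw [← h1, Finset.sum_comm]
      refine Finset.sum_congr rfl fun l _ => ?_
      simp only []
      rw [← Finset.sum_mul]
      congr 1
      rw [hZ]; exact Finset.sum_congr rfl fun k _ => by simp only [hF]; ring
    have h3 := (Finset.sum_eq_zero_iff_of_nonneg (fun l _ => mul_self_nonneg (Z l x))).1 h2 l (Finset.mem_univ _)
    exact mul_self_eq_zero.1 h3
  set w : Fin m → E m → ℝ := fun i => lap (D i) with hw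
  have hws : ∀ i, Sm (w i) := fun i => (hD i).lap
  have hdivF : ∀ l, ∀ x ∈ Ball m, ∑ k, pd k (F k l) x = w l x := by
    intro l x hx
    have h1 : ∀ k, pd k (F k l) x = pd k (pd k (D l)) x - pd l (pd k (D k)) x := by
      intro k
      rw [hF]; simp only
      rw [pd_sub ((hD l).pd k) ((hD k).pd l) k hx, pd_comm (hD k) k l hx]
    rw [Finset.sum_congr rfl fun k _ => h1 k, Finset.sum_sub_distrib]
    have h2 := pd_zero_of hdiv l hx
    rw [pd_sum _ (fun i _ => (hD i).pd i) l hx] at h2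
    rw [h2, sub_zero]; rfl
  have hdivw : ∀ x ∈ Ball m, ∑ i, pd i (w i) x = 0 := by
    intro x hx
    have h2 := lap_zero_of hdiv hx
    rw [lap_sum _ (fun i _ => (hD i).pd i) hx] at h2
    rw [← h2]
    exact Finset.sum_congr rfl fun i _ => pd_lap (hD i) i hx
  have hlapw : ∀ k, ∀ x ∈ Ball m, lap (w k) x = 0 := by
    intro k x hx
    have h1 : ∀ j, pd j (pd j (w k)) x = pd k (pd j (w j)) x := by
      intro j
      rw [pd_congr (fun y hy => hcl y hy j k) j hx, pd_comm (hws j) j k hx]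
    simp only [lap]
    rw [Finset.sum_congr rfl fun j _ => h1 j]
    have h2 := pd_zero_of hdivw k hx
    rwa [pd_sum _ (fun i _ => (hws i).pd i) k hx] at h2
  set π : E m → ℝ := fun x => ∑ k, x k * w k x with hπ
  have hπs : Sm π := Sm.sum _ fun k _ => (Sm.coord k).mul (hws k)
  have hlapπ : ∀ x ∈ Ball m, lap π x = 0 := by
    intro x hx
    rw [hπ, lap_dot hws hx, hdivw x hx]
    simp [hlapw _ x hx]
  have hdivZ : ∀ x ∈ Ball m, ∑ l, pd l (Z l) x = - π x := by
    intro x hx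
    have h1 : ∀ l, pd l (Z l) x = ∑ k, x k * pd l (F k l) x := by
      intro l
      rw [hZ]; simp only
      rw [pd_dot (fun k => hFs k l) l hx]
      simp [hF]
    rw [Finset.sum_congr rfl fun l _ => h1 l, Finset.sum_comm, hπ, ← Finset.sum_neg_distrib]
    refine Finset.sum_congr rfl fun k _ => ?_
    rw [← Finset.mul_sum, ← mul_neg]
    congr 1
    rw [← hdivF k x hx, ← Finset.sum_neg_distrib]
    refine Finset.sum_congr rfl fun l _ => ?_
    have : ∀ y ∈ Ball m, F k l y = 0 - F l k y := by intro y _; simp only [hF]; ring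
    rw [pd_congr this l hx, pd_sub (Sm.const 0) (hFs l k) l hx, pd_const, zero_sub]
  have hπS : ∀ x ∈ Sph m, π x = 0 := by
    intro x hx
    have hxB := sph_sub hx
    have h1 : ∑ l, pd l (Z l) x = 0 := by
      rw [Finset.sum_congr rfl fun l _ => pd_boundary (hZs l) (hZS l) hx l]
      simp only [Finset.mul_sum]
      rw [Finset.sum_comm]
      refine Finset.sum_eq_zero fun i _ => ?_
      have h2 := pd_zero_of (f := fun x => ∑ l, x l * Z l x) (fun y _ => hXZ y) i hxB
      rw [pd_dot hZs i hxB, hZS i x hx, zero_add] at h2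
      rw [← mul_zero (x i), ← h2, Finset.mul_sum]
      exact Finset.sum_congr rfl fun l _ => by ring
    rw [hdivZ x hxB] at h1
    linarith
  have hπ0 := harm_zero hm hπs hlapπ hπS
  have hw0 : ∀ i, ∀ x ∈ Ball m, w i x = 0 := by
    intro i x hx
    have h1 := euler_max_abs (hws i) one_pos (M := 0) (fun y hy => by
      have h2 := pd_zero_of hπ0 i hy
      rw [hπ, pd_dot hws i hy] at h2
      have h3 : ∑ k, y k * pd i (w k) y = ∑ k, y k * pd k (w i) y :=
        Finset.sum_congr rfl fun k _ => by rw [hcl y hy i k]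
      rw [h3] at h2
      rw [one_mul, add_comm, h2, abs_zero]) x hx
    simpa using h1
  have hlapF : ∀ k l, ∀ x ∈ Ball m, lap (F k l) x = 0 := by
    intro k l x hx
    rw [hF]; simp only
    rw [lap_sub ((hD l).pd k) ((hD k).pd l) hx, ← pd_lap (hD l) k hx, ← pd_lap (hD k) l hx,
      pd_zero_of (hw0 l) k hx, pd_zero_of (hw0 k) l hx, sub_zero]
  have hZ0 : ∀ l, ∀ x ∈ Ball m, Z l x = 0 := by
    intro l
    refine harm_zero hm (hZs l) (fun x hx => ?_) (hZS l)
    rw [hZ]; simp only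
    rw [lap_dot (fun k => hFs k l) hx, hdivF l x hx, hw0 l x hx]
    simp [hlapF _ l x hx]
  have hq0 : ∀ x ∈ Ball m, ∑ k, x k * D k x = 0 := by
    refine harm_zero hm (Sm.sum _ fun k _ => (Sm.coord k).mul (hD k)) (fun x hx => ?_) (fun x hx => ?_)
    · rw [lap_dot hD hx, hdiv x hx]
      have : ∀ k, lap (D k) x = 0 := fun k => hw0 k x hx
      simp [this]
    · rw [← htan x hx]; exact Finset.sum_congr rfl fun k _ => mul_comm _ _
  intro i x hx
  have h1 := euler_max_abs (hD i) one_pos (M := 0) (fun y hy => by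
      have h2 := pd_zero_of hq0 i hy
      rw [pd_dot hD i hy] at h2
      have h3 := hZ0 i y hy
      simp only [hZ, hF, mul_sub, Finset.sum_sub_distrib] at h3
      have : ∑ k, y k * pd k (D i) y + 1 * D i y = 0 := by linarith
      rw [this, abs_zero]) x hx
  simpa using h1
end

section
open Set Filter Topology MvPolynomial
namespace Pol
variable {m : ℕ}

/-- evaluation of a polynomial as a function on Euclidean space -/
def ev (p : Pol m) (x : E m) : ℝ := eval (fun i => x i) p

@[simp] theorem ev_add (p q : Pol m) (x : E m) : ev (p + q) x = ev p x + ev q x := by simp [ev]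
@[simp] theorem ev_sub (p q : Pol m) (x : E m) : ev (p - q) x = ev p x - ev q x := by simp [ev]
@[simp] theorem ev_neg (p : Pol m) (x : E m) : ev (-p) x = -ev p x := by simp [ev]
@[simp] theorem ev_mul (p q : Pol m) (x : E m) : ev (p * q) x = ev p x * ev q x := by simp [ev]
@[simp] theorem ev_smul (c : ℝ) (q : Pol m) (x : E m) : ev (c • q) x = c * ev q x := by simp [ev]
@[simp] theorem ev_X (i : Fin m) (x : E m) : ev (X i) x = x i := by simp [ev]
@[simp] theorem ev_C (c : ℝ) (x : E m) : ev (C c : Pol m) x = c := by simp [ev]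
@[simp] theorem ev_zero (x : E m) : ev (0 : Pol m) x = 0 := by simp [ev]
@[simp] theorem ev_sum {ι : Type*} (s : Finset ι) (p : ι → Pol m) (x : E m) :
    ev (∑ i ∈ s, p i) x = ∑ i ∈ s, ev (p i) x := by simp [ev]

theorem ev_contDiff (p : Pol m) : ContDiff ℝ (⊤ : ℕ∞) (ev p) := by
  induction p using MvPolynomial.induction_on with
  | C a =>
    have : (ev (C a : Pol m)) = fun _ => a := by ext; simp
    rw [this]; exact contDiff_const
  | add p q hp hq =>
    have : (ev (p + q)) = fun x => ev p x + ev q x := by ext; simp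
    rw [this]; exact ContDiff.add hp hq
  | mul_X p i hp =>
    have : (ev (p * X i)) = fun x => ev p x * x i := by ext; simp
    rw [this]; exact ContDiff.mul hp (EuclideanSpace.proj (𝕜 := ℝ) i : E m →L[ℝ] ℝ).contDiff

theorem sm_ev (p : Pol m) : Sm (ev p) := (ev_contDiff p).contDiffOn

theorem pd_ev (i : Fin m) (p : Pol m) {x : E m} (hx : x ∈ Ball m) :
    pd i (ev p) x = ev (pderiv i p) x := by
  induction p using MvPolynomial.induction_on with
  | C a =>
    have : (ev (C a : Pol m)) = fun _ => a := by ext; simp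
    rw [this, pd_const]; simp
  | add p q hp hq =>
    have : (ev (p + q)) = fun x => ev p x + ev q x := by ext; simp
    rw [this, pd_add (sm_ev p) (sm_ev q) i hx, hp, hq]; simp
  | mul_X p j hp =>
    have : (ev (p * X j)) = fun x => ev p x * x j := by ext; simp
    rw [this, pd_mul (sm_ev p) (Sm.coord j) i hx, hp, pd_coord i j hx, pderiv_mul, pderiv_X]
    by_cases h : j = i
    · subst h; simp
    · simp [h, Ne.symm h]

theorem lap_ev (p : Pol m) {x : E m} (hx : x ∈ Ball m) : lap (ev p) x = ev (lp p) x := by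
  rw [lp_apply, ev_sum, lap]
  refine Finset.sum_congr rfl fun i _ => ?_
  rw [pd_congr (fun y hy => pd_ev i p hy) i hx, pd_ev i _ hx]

theorem eu_ev (p : Pol m) {x : E m} (hx : x ∈ Ball m) : ∑ i, x i * pd i (ev p) x = ev (eu p) x := by
  rw [eu_apply, ev_sum]
  refine Finset.sum_congr rfl fun i _ => ?_
  rw [pd_ev i p hx]; simp

theorem ev_sq {x : E m} (hx : x ∈ Sph m) : ev (sq : Pol m) x = 0 := by
  have h := sum_sq_eq hx
  have : (1 : Pol m) = C 1 := by simp
  rw [sq, ev_sub, ev_sum, this, ev_C]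
  simp [h]

theorem eq_zero_of_ball {p : Pol m} (h : ∀ x ∈ Ball m, ev p x = 0) : p = 0 := by
  refine MvPolynomial.funext_set (fun _ => Icc (0:ℝ) (1 / (m + 1))) (fun _ => Icc_infinite (by positivity)) ?_
  intro x hx
  have h1 := h (WithLp.toLp 2 x) (by
    have : ‖(WithLp.toLp 2 x : E m)‖ ^ 2 ≤ 1 := by
      rw [norm_sq_eq]
      calc ∑ j, x j * x j ≤ ∑ j : Fin m, (1 / ((m:ℝ) + 1)) := by
            refine Finset.sum_le_sum fun j _ => ?_
            have := hx j (mem_univ _)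
            have h1 : 1 / ((m:ℝ)+1) ≤ 1 := by
              rw [div_le_one (by positivity)]; linarith [Nat.cast_nonneg (α := ℝ) m]
            nlinarith [this.1, this.2]
        _ ≤ 1 := by
            simp; rw [← div_eq_mul_inv, div_le_one (by positivity)]; linarith
    simp only [Ball, mem_closedBall_zero_iff]
    nlinarith [norm_nonneg (WithLp.toLp 2 x : E m)])
  simpa [ev] using h1

theorem sq_ne : (sq : Pol m) ≠ 0 := by
  intro h
  have := congrArg (fun p => ev p 0) h
  have e : (1 : Pol m) = C 1 := by simp
  simp only [sq, ev_sub, ev_sum, e, ev_C] at this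
  simp at this

theorem inj (hm : 0 < m) (w : Pol m) (h : lp (sq * w) = 0) : w = 0 := by
  have h1 : sq * w = 0 := eq_zero_of_ball (harm_zero hm (sm_ev _) (fun x hx => by rw [lap_ev _ hx, h, ev_zero])
    (fun x hx => by rw [ev_mul, ev_sq hx, zero_mul]))
  exact (mul_eq_zero.1 h1).resolve_left sq_ne

/-- `u ↦ Δ((|x|²-1)u)` -/
def aA : Pol m →ₗ[ℝ] Pol m := lp ∘ₗ LinearMap.mulLeft ℝ sq

theorem aA_apply (u : Pol m) : aA u = lp (sq * u) := rfl

theorem td_pderiv (i : Fin m) {p : Pol m} (h : pderiv i p ≠ 0) :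
    (pderiv i p).totalDegree + 1 ≤ p.totalDegree := by
  have hne : (pderiv i p).support.Nonempty := by
    rwa [Finset.nonempty_iff_ne_empty, Ne, support_eq_empty]
  obtain ⟨s, hs, he⟩ := Finset.exists_mem_eq_sup _ hne (fun s => s.sum fun _ e => e)
  rw [totalDegree, he]
  have h1 : s + Finsupp.single i 1 ∈ p.support := by
    rw [mem_support_iff] at hs ⊢
    intro h0
    apply hs
    rw [coeff_pderiv, h0]; simp
  have := le_totalDegree h1
  rw [Finsupp.sum_add_index' (by simp) (by simp)] at this
  simpa using this

theorem aA_mem {p : Pol m} {n : ℕ} (h : p ∈ restrictTotalDegree (Fin m) ℝ n) :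
    aA p ∈ restrictTotalDegree (Fin m) ℝ n := by
  rw [aA_apply, lp_sq_mul]
  have h1 : eu p ∈ restrictTotalDegree (Fin m) ℝ n := by
    rw [eu_apply]
    refine Submodule.sum_mem _ fun i _ => ?_
    by_cases h0 : pderiv i p = 0
    · rw [h0, mul_zero]; exact Submodule.zero_mem _
    · rw [mem_restrictTotalDegree] at h ⊢
      have := td_pderiv i h0
      have h2 := totalDegree_mul (X i) (pderiv i p)
      rw [totalDegree_X] at h2; omega
  have h2 : sq * lp p ∈ restrictTotalDegree (Fin m) ℝ n := by
    rw [lp_apply, Finset.mul_sum]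
    refine Submodule.sum_mem _ fun i _ => ?_
    by_cases h0 : pderiv i (pderiv i p) = 0
    · rw [h0, mul_zero]; exact Submodule.zero_mem _
    · rw [mem_restrictTotalDegree] at h ⊢
      have h3 : pderiv i p ≠ 0 := fun h => h0 (by rw [h, map_zero])
      have := td_pderiv i h0
      have := td_pderiv i h3
      have h2 := totalDegree_mul sq (pderiv i (pderiv i p))
      have h4 : (sq : Pol m).totalDegree ≤ 2 := by
        rw [sq]
        refine (totalDegree_sub _ _).trans (max_le ?_ (by simp))
        refine totalDegree_finsetSum_le fun i _ => ?_
        refine (totalDegree_mul _ _).trans ?_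
        simp [totalDegree_X]
      omega
  refine Submodule.add_mem _ (Submodule.add_mem _ ?_ ?_) h2
  · rw [four_mul_eq]; exact Submodule.smul_mem _ _ h1
  · rw [mul_assoc, cast_mul, two_mul_eq]; exact Submodule.smul_mem _ _ (Submodule.smul_mem _ _ h)

theorem aA_inj (hm : 0 < m) : Function.Injective (aA : Pol m →ₗ[ℝ] Pol m) := by
  rw [← LinearMap.ker_eq_bot, LinearMap.ker_eq_bot']
  exact fun w h => inj hm w h

theorem aA_surj (hm : 0 < m) : Function.Surjective (aA : Pol m →ₗ[ℝ] Pol m) := by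
  intro f
  set n := f.totalDegree
  have hf : f ∈ restrictTotalDegree (Fin m) ℝ n := by rw [mem_restrictTotalDegree]
  set B := (aA : Pol m →ₗ[ℝ] Pol m).restrict (p := restrictTotalDegree (Fin m) ℝ n) (q := restrictTotalDegree (Fin m) ℝ n) (fun p hp => aA_mem hp)
  have hB : Function.Injective B := fun a b h => Subtype.ext (aA_inj hm (congrArg Subtype.val h))
  obtain ⟨g, hg⟩ := (LinearMap.injective_iff_surjective (f := B)).1 hB ⟨f, hf⟩
  exact ⟨g, congrArg Subtype.val hg⟩

open Classical in
/-- inverse of `aA` -/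
def aI : Pol m →ₗ[ℝ] Pol m := if hm : 0 < m then
  ((LinearEquiv.ofBijective aA ⟨aA_inj hm, aA_surj hm⟩).symm : Pol m →ₗ[ℝ] Pol m) else 0

theorem lp_aI (hm : 0 < m) (f : Pol m) : lp (sq * aI f) = f := by
  rw [← aA_apply, aI, dif_pos hm]
  exact (LinearEquiv.ofBijective aA ⟨aA_inj hm, aA_surj hm⟩).apply_symm_apply f

/-- harmonic extension of boundary values. -/
def hP (f : Pol m) : Pol m := f - sq * aI (lp f)

theorem lp_hP (hm : 0 < m) (f : Pol m) : lp (hP f) = 0 := by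
  rw [hP, map_sub, lp_aI hm, sub_self]

theorem hP_sub (f g : Pol m) : hP (f - g) = hP f - hP g := by
  simp only [hP, map_sub]; ring

theorem rot_hP (hm : 0 < m) (i j : Fin m) (f : Pol m) : rot i j (hP f) = hP (rot i j f) := by
  have h1 : lp (rot i j (hP f)) = 0 := by rw [rot_lp, lp_hP hm, map_zero]
  have h2 := lp_hP hm (rot i j f)
  have h3 : lp (sq * (aI (lp (rot i j f)) - rot i j (aI (lp f)))) = 0 := by
    have : sq * (aI (lp (rot i j f)) - rot i j (aI (lp f))) = rot i j (hP f) - hP (rot i j f) := by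
      rw [hP, hP, map_sub, Derivation.leibniz, rot_sq]; simp only [smul_eq_mul]; ring
    rw [this, map_sub, h1, h2, sub_zero]
  have h4 := inj hm _ h3
  rw [hP, hP, map_sub, Derivation.leibniz, rot_sq, sub_eq_zero.1 h4]; simp

theorem ev_hP {x : E m} (hx : x ∈ Sph m) (f : Pol m) : ev (hP f) x = ev f x := by
  rw [hP, ev_sub, ev_mul, ev_sq hx]; ring

end Pol
end

section
open Set Filter Topology MvPolynomial
namespace Pol
variable {m : ℕ} {ι : Type*} {l : Filter ι}

/-- uniform convergence to zero on the ball -/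
def UU (l : Filter ι) (p : ι → Pol m) : Prop := ∀ ε > 0, ∀ᶠ n in l, ∀ x ∈ Ball m, |ev (p n) x| ≤ ε

theorem UU.bound {p q : ι → Pol m} (hp : UU l p) (C : ℝ) (hC : 0 < C)
    (h : ∀ n, ∀ M, (∀ x ∈ Ball m, |ev (p n) x| ≤ M) → ∀ x ∈ Ball m, |ev (q n) x| ≤ C * M) : UU l q := by
  intro ε hε
  filter_upwards [hp (ε / C) (by positivity)] with n hn
  have := h n _ hn
  rwa [mul_div_cancel₀ _ hC.ne'] at this

theorem UU.add {p q : ι → Pol m} (hp : UU l p) (hq : UU l q) : UU l (fun n => p n + q n) := by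
  intro ε hε
  filter_upwards [hp (ε / 2) (by positivity), hq (ε / 2) (by positivity)] with n h1 h2 x hx
  rw [ev_add]
  have := abs_add_le (ev (p n) x) (ev (q n) x)
  linarith [h1 x hx, h2 x hx]

theorem UU.smul {p : ι → Pol m} (hp : UU l p) (c : ℝ) : UU l (fun n => c • p n) := by
  refine hp.bound (|c| + 1) (by positivity) fun n M h x hx => ?_
  rw [ev_smul, abs_mul]
  nlinarith [h x hx, abs_nonneg c, abs_nonneg (ev (p n) x)]

theorem UU.zero : UU l (fun _ => (0 : Pol m)) := by
  intro ε hε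
  exact Eventually.of_forall fun n x hx => by simp [hε.le]

theorem UU.sum {κ : Type*} (s : Finset κ) {p : κ → ι → Pol m} (hp : ∀ k, UU l (p k)) :
    UU l (fun n => ∑ k ∈ s, p k n) := by
  classical
  induction s using Finset.induction_on with
  | empty => simpa using UU.zero
  | insert a s ha ih => simp only [Finset.sum_insert ha]; exact (hp a).add ih

theorem coord_le {x : E m} (hx : x ∈ Ball m) (i : Fin m) : |x i| ≤ 1 := by
  have h : ‖x‖ ≤ 1 := by simpa [Ball] using hx
  exact (PiLp.norm_apply_le x i).trans h

theorem UU.X_mul {p : ι → Pol m} (hp : UU l p) (i : Fin m) : UU l (fun n => X i * p n) := by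
  refine hp.bound 1 one_pos fun n M h x hx => ?_
  rw [ev_mul, ev_X, abs_mul]
  nlinarith [h x hx, coord_le hx i, abs_nonneg (x i), abs_nonneg (ev (p n) x)]

theorem UU.tt {p : ι → Pol m} (hp : UU l p) {c : ℝ} (hc : 0 < c) : UU l (fun n => tt c (p n)) := by
  refine hp.bound c⁻¹ (by positivity) fun n M h x hx => ?_
  have := euler_max_abs (sm_ev (Pol.tt c (p n))) hc (M := M) (fun y hy => by
    rw [eu_ev _ hy, ← ev_smul, ← ev_add, eu_tt hc]; exact h y hy) x hx
  rw [inv_mul_eq_div, le_div_iff₀ hc]; linarith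

theorem UU.hP (hm : 0 < m) {p : ι → Pol m} (hp : UU l p) : UU l (fun n => hP (p n)) := by
  refine hp.bound 1 one_pos fun n M h x hx => ?_
  rw [one_mul]
  exact max_principle_abs hm (sm_ev _) (fun y hy => by rw [lap_ev _ hy, lp_hP hm, ev_zero])
    (fun y hy => by rw [ev_hP hy]; exact h y (sph_sub hy)) x hx

/-- convergence to zero with all derivatives -/
inductive VV (l : Filter ι) (p : ι → Pol m) : Prop
  | mk (R : (ι → Pol m) → Prop) (h0 : R p) (h1 : ∀ q, R q → UU l q)
    (h2 : ∀ q, R q → ∀ i, R (fun n => pderiv i (q n))) : VV l p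

theorem VV.uu {p : ι → Pol m} (h : VV l p) : UU l p := by
  obtain ⟨R, h0, h1, h2⟩ := h; exact h1 p h0

theorem VV.d {p : ι → Pol m} (h : VV l p) (i : Fin m) : VV l (fun n => pderiv i (p n)) := by
  obtain ⟨R, h0, h1, h2⟩ := h; exact ⟨R, h2 p h0 i, h1, h2⟩

theorem VV.add {p q : ι → Pol m} (hp : VV l p) (hq : VV l q) : VV l (fun n => p n + q n) := by
  refine ⟨fun r => ∃ p q, VV l p ∧ VV l q ∧ r = fun n => p n + q n, ⟨p, q, hp, hq, rfl⟩, ?_, ?_⟩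
  · rintro _ ⟨p, q, hp, hq, rfl⟩; exact hp.uu.add hq.uu
  · rintro _ ⟨p, q, hp, hq, rfl⟩ i; exact ⟨_, _, hp.d i, hq.d i, by simp⟩

theorem VV.smul {p : ι → Pol m} (hp : VV l p) (c : ℝ) : VV l (fun n => c • p n) := by
  refine ⟨fun r => ∃ p, VV l p ∧ r = fun n => c • p n, ⟨p, hp, rfl⟩, ?_, ?_⟩
  · rintro _ ⟨p, hp, rfl⟩; exact hp.uu.smul c
  · rintro _ ⟨p, hp, rfl⟩ i; exact ⟨_, hp.d i, by simp⟩

theorem VV.sub {p q : ι → Pol m} (hp : VV l p) (hq : VV l q) : VV l (fun n => p n - q n) := by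
  simpa [sub_eq_add_neg] using hp.add (hq.smul (-1))

theorem VV.zero : VV l (fun _ => (0 : Pol m)) := by
  refine ⟨fun r => r = fun _ => 0, rfl, ?_, ?_⟩
  · rintro _ rfl; exact UU.zero
  · rintro _ rfl i; simp

theorem VV.sum {κ : Type*} (s : Finset κ) {p : κ → ι → Pol m} (hp : ∀ k, VV l (p k)) :
    VV l (fun n => ∑ k ∈ s, p k n) := by
  classical
  induction s using Finset.induction_on with
  | empty => simpa using VV.zero
  | insert a s ha ih => simp only [Finset.sum_insert ha]; exact (hp a).add ih

theorem VV.X_mul {p : ι → Pol m} (hp : VV l p) (i : Fin m) : VV l (fun n => X i * p n) := by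
  classical
  refine ⟨fun r => ∃ p q, VV l p ∧ VV l q ∧ r = fun n => X i * p n + q n, ⟨p, _, hp, VV.zero, by simp⟩, ?_, ?_⟩
  · rintro _ ⟨p, q, hp, hq, rfl⟩; exact (hp.uu.X_mul i).add hq.uu
  · rintro _ ⟨p, q, hp, hq, rfl⟩ j
    refine ⟨_, _, hp.d j, (hp.smul (if i = j then 1 else 0)).add (hq.d j), ?_⟩
    funext n
    rw [map_add, pderiv_mul, pderiv_X]
    by_cases h : i = j
    · subst h; simp; ring
    · simp [h, Ne.symm h]

theorem VV.tt {p : ι → Pol m} (hp : VV l p) {c : ℝ} (hc : 0 < c) : VV l (fun n => tt c (p n)) := by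
  refine ⟨fun r => ∃ c > 0, ∃ p, VV l p ∧ r = fun n => Pol.tt c (p n), ⟨c, hc, p, hp, rfl⟩, ?_, ?_⟩
  · rintro _ ⟨c, hc, p, hp, rfl⟩; exact hp.uu.tt hc
  · rintro _ ⟨c, hc, p, hp, rfl⟩ j; exact ⟨c + 1, by linarith, _, hp.d j, by simp [d_tt hc]⟩

theorem VV.rot {p : ι → Pol m} (hp : VV l p) (i j : Fin m) : VV l (fun n => rot i j (p n)) := by
  simp only [rot_apply]
  exact ((hp.d j).X_mul i).sub ((hp.d i).X_mul j)

theorem VV.sq_mul {p : ι → Pol m} (hp : VV l p) : VV l (fun n => sq * p n) := by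
  have : ∀ n, sq * p n = ∑ i, X i * (X i * p n) - p n := by
    intro n; rw [sq, sub_mul, Finset.sum_mul, one_mul]
    congr 1; exact Finset.sum_congr rfl fun i _ => by ring
  simp only [this]
  exact (VV.sum _ fun i => (hp.X_mul i).X_mul i).sub hp

/-- convergence to zero with all rotational derivatives -/
inductive VL (l : Filter ι) (p : ι → Pol m) : Prop
  | mk (R : (ι → Pol m) → Prop) (h0 : R p) (h1 : ∀ q, R q → UU l q)
    (h2 : ∀ q, R q → ∀ i j, R (fun n => rot i j (q n))) : VL l p

theorem VL.uu {p : ι → Pol m} (h : VL l p) : UU l p := by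
  obtain ⟨R, h0, h1, h2⟩ := h; exact h1 p h0

theorem VL.rot {p : ι → Pol m} (h : VL l p) (i j : Fin m) : VL l (fun n => rot i j (p n)) := by
  obtain ⟨R, h0, h1, h2⟩ := h; exact ⟨R, h2 p h0 i j, h1, h2⟩

theorem VV.vl {p : ι → Pol m} (h : VV l p) : VL l p :=
  ⟨VV l, h, fun _ h => h.uu, fun _ h i j => h.rot i j⟩

theorem VL.add {p q : ι → Pol m} (hp : VL l p) (hq : VL l q) : VL l (fun n => p n + q n) := by
  refine ⟨fun r => ∃ p q, VL l p ∧ VL l q ∧ r = fun n => p n + q n, ⟨p, q, hp, hq, rfl⟩, ?_, ?_⟩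
  · rintro _ ⟨p, q, hp, hq, rfl⟩; exact hp.uu.add hq.uu
  · rintro _ ⟨p, q, hp, hq, rfl⟩ i j; exact ⟨_, _, hp.rot i j, hq.rot i j, by simp⟩

theorem VL.smul {p : ι → Pol m} (hp : VL l p) (c : ℝ) : VL l (fun n => c • p n) := by
  refine ⟨fun r => ∃ p, VL l p ∧ r = fun n => c • p n, ⟨p, hp, rfl⟩, ?_, ?_⟩
  · rintro _ ⟨p, hp, rfl⟩; exact hp.uu.smul c
  · rintro _ ⟨p, hp, rfl⟩ i j; exact ⟨_, hp.rot i j, by simp⟩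

theorem VL.hP (hm : 0 < m) {p : ι → Pol m} (hp : VL l p) : VL l (fun n => hP (p n)) := by
  refine ⟨fun r => ∃ p, VL l p ∧ r = fun n => Pol.hP (p n), ⟨p, hp, rfl⟩, ?_, ?_⟩
  · rintro _ ⟨p, hp, rfl⟩; exact hp.uu.hP hm
  · rintro _ ⟨p, hp, rfl⟩ i j; exact ⟨_, hp.rot i j, by simp [rot_hP hm]⟩

theorem VL.eu (hm : 2 ≤ m) {h : ι → Pol m} (hp : VL l h) (hh : ∀ n, lp (h n) = 0) :
    UU l (fun n => eu (h n)) := by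
  have hc : 0 < (m:ℝ) - 1 := by
    have : (2:ℝ) ≤ m := by exact_mod_cast hm
    linarith
  have hk : UU l (fun n => (-1/2 : ℝ) • ∑ i, ∑ j, Pol.rot i j (Pol.rot i j (h n))) :=
    (UU.sum _ fun i => UU.sum _ fun j => ((hp.rot i j).rot i j).uu).smul _
  have := (hk.tt hc).add (hp.uu.add ((hp.uu.tt hc).smul (-((m:ℝ) - 1))))
  convert this using 2 with n
  set g := Pol.eu (h n) with hg
  have e1 : (-1/2 : ℝ) • ∑ i, ∑ j, Pol.rot i j (Pol.rot i j (h n)) = Pol.eu g + ((m:ℝ) - 2) • g := by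
    rw [sum_rot_rot, hh, two_mul_eq, smul_smul]
    have : ((m:Pol m) - 2) * Pol.eu (h n) = ((m:ℝ) - 2) • g := by
      rw [sub_mul, cast_mul, two_mul_eq, sub_smul]
    rw [this]; norm_num
    abel
  have e3 : g = Pol.tt ((m:ℝ) - 1) (Pol.eu g + ((m:ℝ)-1) • g) := tt_unique hc rfl
  have e4 : h n = Pol.tt ((m:ℝ) - 1) (g + ((m:ℝ)-1) • h n) := tt_unique hc rfl
  rw [e1]
  rw [map_add, map_smul] at e4
  have e6 : Pol.tt ((m:ℝ) - 1) g = h n - ((m:ℝ)-1) • Pol.tt ((m:ℝ) - 1) (h n) := eq_sub_of_add_eq e4.symm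
  conv_lhs => rw [e3]
  simp only [map_add, map_smul]
  rw [e6]
  module

theorem VL.d_uu (hm : 2 ≤ m) {h : ι → Pol m} (hp : VL l h) (hh : ∀ n, lp (h n) = 0) (i : Fin m) :
    UU l (fun n => pderiv i (h n)) := by
  have h1 : UU l (fun n => X i * Pol.eu (h n) + ∑ j, X j * Pol.rot j i (h n)) :=
    ((hp.eu hm hh).X_mul i).add (UU.sum _ fun j => (hp.rot j i).uu.X_mul j)
  refine h1.bound 1 one_pos fun n M hM => ?_
  rw [one_mul]
  refine max_principle_abs (by omega) (sm_ev _) (fun y hy => by rw [lap_ev _ hy, ← d_lp, hh, map_zero, ev_zero])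
    (fun y hy => ?_)
  have := hM y (sph_sub hy)
  rw [← sq_d, ev_mul, ev_add, ev_sq hy] at this
  have e : ev (1 : Pol m) y = 1 := by simp [ev]
  rwa [e, zero_add, one_mul] at this

theorem VL.d (hm : 2 ≤ m) {h : ι → Pol m} (hp : VL l h) (hh : ∀ n, lp (h n) = 0) (i : Fin m) :
    VL l (fun n => pderiv i (h n)) := by
  classical
  refine ⟨fun r => ∃ h : Fin m → ι → Pol m, (∀ i, VL l (h i)) ∧ (∀ i n, lp (h i n) = 0) ∧
    r = fun n => ∑ i, pderiv i (h i n), ⟨fun j => if j = i then h else fun _ => 0, ?_, ?_, ?_⟩, ?_, ?_⟩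
  · intro j; dsimp only; split_ifs
    · exact hp
    · exact VV.zero.vl
  · intro j n; dsimp only; split_ifs
    · exact hh n
    · simp
  · funext n
    rw [Finset.sum_eq_single i]
    · simp
    · intro b _ hb; simp [hb]
    · simp
  · rintro _ ⟨h, hp, hh, rfl⟩
    exact UU.sum _ fun i => (hp i).d_uu hm (hh i) i
  · rintro _ ⟨h, hp, hh, rfl⟩ a b
    refine ⟨fun k n => Pol.rot a b (h k n) + (-(if k = b then 1 else 0) : ℝ) • h a n + (if k = a then 1 else 0 : ℝ) • h b n, ?_, ?_, ?_⟩
    · intro k; exact (((hp k).rot a b).add ((hp a).smul _)).add ((hp b).smul _)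
    · intro k n; simp only [map_add, map_smul, rot_lp, hh, map_zero, smul_zero, add_zero]
    · funext n
      simp only [map_sum, rot_d, map_add, Derivation.map_smul, Finset.sum_add_distrib, Finset.sum_sub_distrib]
      simp [sub_eq_add_neg, add_assoc, add_comm]

theorem VL.vv (hm : 2 ≤ m) {h : ι → Pol m} (hp : VL l h) (hh : ∀ n, lp (h n) = 0) : VV l h := by
  refine ⟨fun r => VL l r ∧ ∀ n, lp (r n) = 0, ⟨hp, hh⟩, fun q hq => hq.1.uu, fun q hq i => ⟨hq.1.d hm hq.2 i, fun n => ?_⟩⟩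
  rw [← d_lp, hq.2, map_zero]

theorem VV.hP (hm : 2 ≤ m) {p : ι → Pol m} (hp : VV l p) : VV l (fun n => hP (p n)) :=
  (hp.vl.hP (by omega)).vv hm fun n => lp_hP (by omega) _

end Pol
end

section
open Set Filter Topology MvPolynomial
namespace Pol
variable {m : ℕ}

/-- Cauchy sequences for the smooth topology on the ball -/
def Cau (p : ℕ → Pol m) : Prop := VV (atTop ×ˢ atTop) (fun n : ℕ × ℕ => p n.1 - p n.2)

theorem Cau.add {p q : ℕ → Pol m} (hp : Cau p) (hq : Cau q) : Cau (fun n => p n + q n) := by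
  have := VV.add hp hq
  simp only [Cau]; convert this using 2; ring
theorem Cau.sub {p q : ℕ → Pol m} (hp : Cau p) (hq : Cau q) : Cau (fun n => p n - q n) := by
  have := VV.sub hp hq
  simp only [Cau]; convert this using 2; ring
theorem Cau.smul {p : ℕ → Pol m} (hp : Cau p) (c : ℝ) : Cau (fun n => c • p n) := by
  have := VV.smul hp c
  simp only [Cau]; convert this using 2; rw [smul_sub]
theorem Cau.neg {p : ℕ → Pol m} (hp : Cau p) : Cau (fun n => - p n) := by
  have := hp.smul (-1)
  simpa using this
theorem Cau.sum {κ : Type*} (s : Finset κ) {p : κ → ℕ → Pol m} (hp : ∀ k, Cau (p k)) :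
    Cau (fun n => ∑ k ∈ s, p k n) := by
  have := VV.sum s hp
  simp only [Cau]; convert this using 2; rw [Finset.sum_sub_distrib]
theorem Cau.X_mul {p : ℕ → Pol m} (hp : Cau p) (i : Fin m) : Cau (fun n => X i * p n) := by
  have := VV.X_mul hp i
  simp only [Cau]; convert this using 2; ring
theorem Cau.sq_mul {p : ℕ → Pol m} (hp : Cau p) : Cau (fun n => sq * p n) := by
  have := VV.sq_mul hp
  simp only [Cau]; convert this using 2; ring
theorem Cau.d {p : ℕ → Pol m} (hp : Cau p) (i : Fin m) : Cau (fun n => pderiv i (p n)) := by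
  have := VV.d hp i
  simp only [Cau]; convert this using 2; rw [map_sub]
theorem Cau.tt {p : ℕ → Pol m} (hp : Cau p) {c : ℝ} (hc : 0 < c) : Cau (fun n => tt c (p n)) := by
  have := VV.tt hp hc
  simp only [Cau]; convert this using 2; rw [map_sub]
theorem Cau.hP (hm : 2 ≤ m) {p : ℕ → Pol m} (hp : Cau p) : Cau (fun n => hP (p n)) := by
  have := VV.hP hm hp
  simp only [Cau]; convert this using 2; rw [hP_sub]

theorem Cau.eventually {p : ℕ → Pol m} (hp : Cau p) {ε : ℝ} (hε : 0 < ε) :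
    ∃ N, ∀ n ≥ N, ∀ n' ≥ N, ∀ x ∈ Ball m, |ev (p n) x - ev (p n') x| ≤ ε := by
  have h := VV.uu hp ε hε
  rw [prod_atTop_atTop_eq, eventually_atTop_prod_self] at h
  obtain ⟨N, hN⟩ := h
  exact ⟨N, fun n hn n' hn' x hx => by simpa using hN n n' hn hn' x hx⟩

/-- smooth limit -/
def Lim (p : ℕ → Pol m) (f : E m → ℝ) : Prop :=
  Cau p ∧ ∀ x ∈ Ball m, Tendsto (fun n => ev (p n) x) atTop (𝓝 (f x))

theorem Cau.exists_lim {p : ℕ → Pol m} (hp : Cau p) : ∃ f, Lim p f := by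
  have : ∀ x, ∃ y, x ∈ Ball m → Tendsto (fun n => ev (p n) x) atTop (𝓝 y) := by
    intro x
    by_cases hx : x ∈ Ball m
    · have : CauchySeq (fun n => ev (p n) x) := by
        rw [Metric.cauchySeq_iff]
        intro ε hε
        obtain ⟨N, hN⟩ := hp.eventually (half_pos hε)
        refine ⟨N, fun a ha b hb => ?_⟩
        rw [Real.dist_eq]
        exact (hN a ha b hb x hx).trans_lt (half_lt_self hε)
      obtain ⟨y, hy⟩ := cauchySeq_tendsto_of_complete this
      exact ⟨y, fun _ => hy⟩
    · exact ⟨0, fun h => absurd h hx⟩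
  choose f hf using this
  exact ⟨f, hp, fun x hx => hf x hx⟩

theorem ev_fderiv (p : Pol m) {x : E m} (hx : x ∈ Ball m) (v : E m) :
    fderivWithin ℝ (ev p) (Ball m) x v = ∑ i, v i * ev (pderiv i p) x := by
  rw [fderiv_eq_sum]
  exact Finset.sum_congr rfl fun i _ => by rw [pd_ev i p hx]

theorem sum_coord_le (v : E m) (g : Fin m → ℝ) {M : ℝ} (h : ∀ i, |g i| ≤ M) :
    |∑ i, v i * g i| ≤ m * M * ‖v‖ := by
  calc |∑ i, v i * g i| ≤ ∑ i, |v i * g i| := Finset.abs_sum_le_sum_abs _ _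
    _ ≤ ∑ i : Fin m, ‖v‖ * M := by
      refine Finset.sum_le_sum fun i _ => ?_
      rw [abs_mul]
      exact mul_le_mul (PiLp.norm_apply_le v i) (h i) (abs_nonneg _) (norm_nonneg _)
    _ = m * M * ‖v‖ := by simp; ring

theorem ev_lip (p : Pol m) {M : ℝ} (h : ∀ x ∈ Ball m, ∀ i, |ev (pderiv i p) x| ≤ M) {x y : E m}
    (hx : x ∈ Ball m) (hy : y ∈ Ball m) : |ev p y - ev p x| ≤ m * M * ‖y - x‖ := by
  by_cases hM : 0 ≤ M
  · refine ball_convex.norm_image_sub_le_of_norm_hasFDerivWithin_le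
      (fun z hz => ((sm_ev p).diff hz).hasFDerivWithinAt) (fun z hz => ?_) hx hy
    refine ContinuousLinearMap.opNorm_le_bound _ (by positivity) fun v => ?_
    rw [ev_fderiv p hz, Real.norm_eq_abs]
    exact sum_coord_le v _ (h z hz)
  · rcases Nat.eq_zero_or_pos m with h0 | h0
    · subst h0
      have : x = y := Subsingleton.elim _ _
      simp [this]
    · exact absurd ((abs_nonneg _).trans (h x hx ⟨0, h0⟩)) hM

theorem Lim.hasFDeriv {p : ℕ → Pol m} {f : E m → ℝ} (h : Lim p f) {g : Fin m → E m → ℝ}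
    (hg : ∀ i, Lim (fun n => pderiv i (p n)) (g i)) {x : E m} (hx : x ∈ Ball m) :
    HasFDerivWithinAt f (∑ i, g i x • (EuclideanSpace.proj (𝕜 := ℝ) i : E m →L[ℝ] ℝ)) (Ball m) x := by
  rw [hasFDerivWithinAt_iff_isLittleO, Asymptotics.isLittleO_iff]
  intro c hc
  set ε : ℝ := c / (2 * m + 1) with hε
  have hεp : 0 < ε := by positivity
  have h1 : ∃ N, ∀ n ≥ N, ∀ n' ≥ N, ∀ i, ∀ x ∈ Ball m, |ev (pderiv i (p n)) x - ev (pderiv i (p n')) x| ≤ ε := by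
    choose N hN using fun i => (hg i).1.eventually hεp
    refine ⟨Finset.univ.sup N, fun n hn n' hn' i => hN i n ?_ n' ?_⟩
    · exact (Finset.le_sup (Finset.mem_univ i)).trans hn
    · exact (Finset.le_sup (Finset.mem_univ i)).trans hn'
  obtain ⟨N, hN⟩ := h1
  have h2 : ∀ y ∈ Ball m, |(ev (p N) y - f y) - (ev (p N) x - f x)| ≤ m * ε * ‖y - x‖ := by
    intro y hy
    have ht : Tendsto (fun n => |(ev (p N) y - ev (p n) y) - (ev (p N) x - ev (p n) x)|) atTop
        (𝓝 |(ev (p N) y - f y) - (ev (p N) x - f x)|) :=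
      (((h.2 y hy).const_sub _).sub ((h.2 x hx).const_sub _)).abs
    refine le_of_tendsto ht ?_
    filter_upwards [eventually_ge_atTop N] with n hn
    have := ev_lip (p N - p n) (M := ε) (fun z hz i => by
      rw [map_sub, ev_sub]; exact hN N le_rfl n hn i z hz) hx hy
    simpa using this
  have h3 : ∀ i, |ev (pderiv i (p N)) x - g i x| ≤ ε := by
    intro i
    have ht : Tendsto (fun n => |ev (pderiv i (p N)) x - ev (pderiv i (p n)) x|) atTop
        (𝓝 |ev (pderiv i (p N)) x - g i x|) := (((hg i).2 x hx).const_sub _).abs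
    refine le_of_tendsto ht ?_
    filter_upwards [eventually_ge_atTop N] with n hn
    exact hN N le_rfl n hn i x hx
  have h4 := ((sm_ev (p N)).diff hx).hasFDerivWithinAt
  rw [hasFDerivWithinAt_iff_isLittleO, Asymptotics.isLittleO_iff] at h4
  filter_upwards [h4 hεp, self_mem_nhdsWithin] with y hy hyB
  rw [ev_fderiv _ hx] at hy
  have h5 := sum_coord_le (y - x) (fun i => ev (pderiv i (p N)) x - g i x) h3
  have h6 := h2 y hyB
  simp only [Real.norm_eq_abs] at hy ⊢
  have e : (∑ i, g i x • (EuclideanSpace.proj (𝕜 := ℝ) i : E m →L[ℝ] ℝ)) (y - x) = ∑ i, (y - x) i * g i x := by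
    simp [mul_comm]
  rw [e]
  have e2 : ∑ i, (y - x) i * (ev (pderiv i (p N)) x - g i x) = ∑ i, (y - x) i * ev (pderiv i (p N)) x
      - ∑ i, (y - x) i * g i x := by
    rw [← Finset.sum_sub_distrib]; exact Finset.sum_congr rfl fun i _ => by ring
  rw [e2] at h5
  have e3 : c = (2 * m + 1) * ε := by rw [hε]; field_simp
  rw [e3]
  rw [abs_le] at *
  constructor <;> linarith [h5.1, h5.2, h6.1, h6.2, hy.1, hy.2]

theorem Lim.contDiff (n : ℕ) : ∀ {p : ℕ → Pol m} {f : E m → ℝ}, Lim p f → ContDiffOn ℝ n f (Ball m) := by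
  induction n with
  | zero =>
    intro p f h
    choose g hg using fun i => (h.1.d i).exists_lim
    simp only [Nat.cast_zero, contDiffOn_zero]
    exact fun x hx => (h.hasFDeriv hg hx).continuousWithinAt
  | succ n ih =>
    intro p f h
    choose g hg using fun i => (h.1.d i).exists_lim
    push_cast
    rw [contDiffOn_succ_iff_fderivWithin ball_uniq]
    refine ⟨fun x hx => (h.hasFDeriv hg hx).differentiableWithinAt, by simp, ?_⟩
    have : ContDiffOn ℝ n (fun x => ∑ i, g i x • (EuclideanSpace.proj (𝕜 := ℝ) i : E m →L[ℝ] ℝ)) (Ball m) :=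
      ContDiffOn.sum fun i _ => (ih (hg i)).smul contDiffOn_const
    exact this.congr fun x hx => (h.hasFDeriv hg hx).fderivWithin (ball_uniq x hx)

theorem Lim.sm {p : ℕ → Pol m} {f : E m → ℝ} (h : Lim p f) : Sm f :=
  contDiffOn_infty.2 fun n => h.contDiff n

theorem Lim.d {p : ℕ → Pol m} {f : E m → ℝ} (h : Lim p f) (i : Fin m) :
    Lim (fun n => pderiv i (p n)) (pd i f) := by
  choose g hg using fun i => (h.1.d i).exists_lim
  refine ⟨h.1.d i, fun x hx => ?_⟩
  have : pd i f x = g i x := by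
    rw [pd, (h.hasFDeriv hg hx).fderivWithin (ball_uniq x hx)]
    simp [Pi.single_apply]
  rw [this]; exact (hg i).2 x hx

theorem Lim.lp {p : ℕ → Pol m} {f : E m → ℝ} (h : Lim p f) : Lim (fun n => lp (p n)) (lap f) := by
  simp only [lp_apply]
  refine ⟨Cau.sum _ fun i => (h.1.d i).d i, fun x hx => ?_⟩
  simp only [ev_sum, lap]
  exact tendsto_finsetSum _ fun i _ => ((h.d i).d i).2 x hx

theorem Lim.eq {p : ℕ → Pol m} {f g : E m → ℝ} (h : Lim p f) (h' : Lim p g) {x : E m} (hx : x ∈ Ball m) :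
    f x = g x := tendsto_nhds_unique (h.2 x hx) (h'.2 x hx)

end Pol
end

section
open Set Filter Topology MvPolynomial MeasureTheory
namespace Pol
variable {m : ℕ}

/-- smooth functions supported in the closed ball of radius 2 -/
def Good (F : E m → ℝ) : Prop := ContDiff ℝ (⊤ : ℕ∞) F ∧ ∀ x, 2 < ‖x‖ → F x = 0

/-- full partial derivative -/
def fd (i : Fin m) (F : E m → ℝ) : E m → ℝ := fun x => fderiv ℝ F x (EuclideanSpace.single i 1)

theorem Good.compact {F : E m → ℝ} (h : Good F) : HasCompactSupport F :=
  HasCompactSupport.intro (isCompact_closedBall (0 : E m) 2) fun x hx => h.2 x (by simpa using hx)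

theorem Good.d {F : E m → ℝ} (h : Good F) (i : Fin m) : Good (fd i F) := by
  refine ⟨(h.1.fderiv_right (by simp)).clm_apply contDiff_const, fun x hx => ?_⟩
  have : F =ᶠ[𝓝 x] fun _ => 0 := by
    filter_upwards [(isOpen_lt continuous_const continuous_norm).mem_nhds hx] with y hy using h.2 y hy
  rw [fd, this.fderiv_eq]; simp

theorem conv_poly (q : Pol m) : ∀ F : E m → ℝ, Continuous F → HasCompactSupport F →
    ∃ P : Pol m, ∀ x, ∫ z, ev q (x - z) * F z = ev P x := by
  induction q using MvPolynomial.induction_on with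
  | C a =>
    intro F _ _
    exact ⟨C (∫ z, a * F z), fun x => by simp⟩
  | add p q hp hq =>
    intro F hF hc
    obtain ⟨P, hP⟩ := hp F hF hc
    obtain ⟨Q, hQ⟩ := hq F hF hc
    have hi : ∀ (p : Pol m) x, Integrable fun z => ev p (x - z) * F z := fun p x =>
      Continuous.integrable_of_hasCompactSupport
        (((ev_contDiff p).continuous.comp (by fun_prop)).mul hF) hc.mul_left
    refine ⟨P + Q, fun x => ?_⟩
    rw [ev_add, ← hP, ← hQ, ← integral_add (hi _ _) (hi _ _)]
    congr 1; ext z; simp; ring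
  | mul_X p i hp =>
    intro F hF hc
    have hci : Continuous fun z : E m => z i := (EuclideanSpace.proj (𝕜 := ℝ) i : E m →L[ℝ] ℝ).continuous
    have hF' : Continuous fun z => z i * F z := hci.mul hF
    have hc' : HasCompactSupport fun z => z i * F z := hc.mul_left
    obtain ⟨P, hP⟩ := hp F hF hc
    obtain ⟨Q, hQ⟩ := hp _ hF' hc'
    have hi : ∀ (p : Pol m) x, Integrable fun z => ev p (x - z) * F z := fun p x =>
      Continuous.integrable_of_hasCompactSupport
        (((ev_contDiff p).continuous.comp (by fun_prop)).mul hF) hc.mul_left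
    have hi' : ∀ (p : Pol m) x, Integrable fun z => ev p (x - z) * (z i * F z) := fun p x =>
      Continuous.integrable_of_hasCompactSupport
        (((ev_contDiff p).continuous.comp (by fun_prop)).mul hF') hc'.mul_left
    refine ⟨X i * P - Q, fun x => ?_⟩
    rw [ev_sub, ev_mul, ev_X, ← hP, ← hQ, ← integral_const_mul, ← integral_sub ((hi _ _).const_mul _) (hi' _ _)]
    congr 1; ext z; simp; ring

/-- kernel -/
def cc : Pol m := C 1 - C (1/9) * ∑ i, X i * X i

theorem ev_cc (y : E m) : ev cc y = 1 - ‖y‖ ^ 2 / 9 := by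
  rw [cc, ev_sub, ev_mul, ev_C, ev_C, ev_sum, norm_sq_eq]; simp; ring

theorem ev_pow (p : Pol m) (n : ℕ) (x : E m) : ev (p ^ n) x = ev p x ^ n := by simp [ev]

/-- normalization -/
def an (m n : ℕ) : ℝ := (∫ y in Metric.closedBall (0 : E m) 3, ev cc y ^ n)⁻¹

theorem exists_phi (n : ℕ) (F : E m → ℝ) : ∃ P : Pol m, Good F →
    ∀ x, ev P x = an m n * ∫ y, ev cc y ^ n * F (x - y) := by
  by_cases h : Good F
  · obtain ⟨P, hP⟩ := conv_poly (cc ^ n) F h.1.continuous h.compact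
    refine ⟨an m n • P, fun _ x => ?_⟩
    rw [ev_smul, ← hP, ← integral_sub_left_eq_self _ _ x]
    simp [ev_pow]
  · exact ⟨0, fun h' => absurd h' h⟩

/-- polynomial approximations -/
def phi (n : ℕ) (F : E m → ℝ) : Pol m := (exists_phi n F).choose

theorem ev_phi (n : ℕ) {F : E m → ℝ} (h : Good F) (x : E m) :
    ev (phi n F) x = an m n * ∫ y, ev cc y ^ n * F (x - y) := (exists_phi n F).choose_spec h x

theorem d_phi (n : ℕ) {F : E m → ℝ} (h : Good F) (i : Fin m) :
    pderiv i (phi n F) = phi n (fd i F) := by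
  rw [← sub_eq_zero]
  refine eq_zero_of_ball fun x hx => ?_
  rw [ev_sub, sub_eq_zero, ← pd_ev i _ hx, ev_phi n (h.d i)]
  have hl : LocallyIntegrable (fun y : E m => ev cc y ^ n) volume :=
    ((ev_contDiff cc).continuous.pow n).locallyIntegrable
  have h1 := h.compact.hasFDerivAt_convolution_right (ContinuousLinearMap.mul ℝ ℝ) hl (h.1.of_le (by simp)) x
  have h2 := h1.const_mul (an m n)
  have e : (fun x => an m n * (convolution (fun y : E m => ev cc y ^ n) F (ContinuousLinearMap.mul ℝ ℝ) volume) x) = ev (phi n F) := by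
    ext x; rw [ev_phi n h]; rfl
  rw [e] at h2
  rw [pd, h2.hasFDerivWithinAt.fderivWithin (ball_uniq x hx)]
  rw [ContinuousLinearMap.smul_apply, convolution_precompR_apply _ hl (h.compact.fderiv ℝ) (h.1.continuous_fderiv (by simp))]
  rfl

theorem phi_unif {F : E m → ℝ} (h : Good F) {ε : ℝ} (hε : 0 < ε) :
    ∀ᶠ n in atTop, ∀ x ∈ Ball m, |ev (phi n F) x - F x| ≤ ε := by
  haveI : CompactSpace (Ball m) := isCompact_iff_compactSpace.1 ball_compact
  set G : C(E m, C(Ball m, ℝ)) := ContinuousMap.curry ⟨fun z : E m × Ball m => F (z.2 - z.1),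
    h.1.continuous.comp (by fun_prop)⟩ with hG
  have hGa : ∀ y x, G y x = F (x - y) := fun y x => rfl
  set s := Metric.closedBall (0 : E m) 3 with hs
  have hsc : IsCompact s := isCompact_closedBall _ _
  have hcc : Continuous (ev (cc : Pol m)) := (ev_contDiff cc).continuous
  have key := tendsto_setIntegral_pow_smul_of_unique_maximum_of_isCompact_of_continuousOn
    (μ := (volume : Measure (E m))) (s := s) (x₀ := 0) (c := ev (cc : Pol m)) (g := G) hsc hcc.continuousOn
    (fun y _ hy => by
      rw [ev_cc, ev_cc]
      have : 0 < ‖y‖ := by simpa using hy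
      have : 0 < ‖y‖ ^ 2 := by positivity
      simp; linarith)
    (fun y hy => by
      rw [ev_cc]
      have : ‖y‖ ≤ 3 := by simpa [hs] using hy
      nlinarith [norm_nonneg y])
    (by rw [ev_cc]; simp)
    (by rw [hs, interior_closedBall _ (by norm_num)]; exact subset_closure (by simp))
    G.continuous.continuousOn
  rw [Metric.tendsto_nhds] at key
  filter_upwards [key ε hε] with n hn x hx
  rw [dist_eq_norm] at hn
  have h1 := (ContinuousMap.norm_coe_le_norm _ (⟨x, hx⟩ : Ball m)).trans hn.le
  have hgint : IntegrableOn (fun y => ev (cc : Pol m) y ^ n • G y) s volume :=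
    ((hcc.pow n).smul G.continuous).continuousOn.integrableOn_compact hsc
  rw [ContinuousMap.sub_apply, ContinuousMap.smul_apply, ContinuousMap.integral_apply hgint] at h1
  rw [ev_phi n h]
  have e : ∫ y, ev cc y ^ n * F (x - y) = ∫ y in s, ev cc y ^ n * F (x - y) := by
    refine (setIntegral_eq_integral_of_forall_compl_eq_zero fun y hy => ?_).symm
    rw [h.2, mul_zero]
    have h3 : 3 < ‖y‖ := by simpa [hs] using hy
    have h4 : ‖x‖ ≤ 1 := by simpa [Ball] using hx
    have := norm_sub_norm_le y x
    rw [norm_sub_rev] at this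
    linarith
  rw [e]
  simpa [hGa, an] using h1

theorem phi_lim {F : E m → ℝ} (h : Good F) : Lim (fun n => phi n F) F := by
  refine ⟨⟨fun q => ∃ F, Good F ∧ q = fun n : ℕ × ℕ => phi n.1 F - phi n.2 F, ⟨F, h, rfl⟩, ?_, ?_⟩, ?_⟩
  · rintro _ ⟨F, h, rfl⟩ ε hε
    have h1 := (phi_unif h (half_pos hε)).prod_mk (phi_unif h (half_pos hε))
    filter_upwards [h1] with n hn x hx
    have h2 := abs_le.1 (hn.1 x hx)
    have h3 := abs_le.1 (hn.2 x hx)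
    rw [ev_sub, abs_le]
    constructor <;> linarith [h2.1, h2.2, h3.1, h3.2]
  · rintro _ ⟨F, h, rfl⟩ i
    exact ⟨_, h.d i, by simp [d_phi _ h]⟩
  · intro x hx
    rw [Metric.tendsto_nhds]
    intro ε hε
    filter_upwards [phi_unif h (half_pos hε)] with n hn
    rw [Real.dist_eq]
    linarith [hn x hx]

theorem approx {U : Set (E m)} (hU : IsOpen U) (hB : Ball m ⊆ U) {N : E m → ℝ}
    (hN : ContDiffOn ℝ (⊤ : ℕ∞) N U) : ∃ p, Lim p N := by
  obtain ⟨δ, hδ, hδU⟩ := ball_compact.exists_cthickening_subset_open hU hB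
  set r := min δ 1 with hr
  have hr0 : 0 < r := by positivity
  let b : ContDiffBump (0 : E m) := ⟨1, 1 + r, one_pos, by linarith⟩
  set F : E m → ℝ := fun x => b x * N x with hF
  have hsub : Metric.closedBall (0 : E m) (1 + r) ⊆ U := by
    refine subset_trans ?_ hδU
    rw [Ball, cthickening_closedBall hδ.le zero_le_one]
    exact Metric.closedBall_subset_closedBall (by linarith [min_le_left δ 1])
  have hz : ∀ x, 1 + r ≤ ‖x‖ → b x = 0 := fun x hx => b.zero_of_le_dist (by simpa [b] using hx)
  have hG : Good F := by
    refine ⟨?_, fun x hx => ?_⟩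
    · rw [contDiff_iff_contDiffAt]
      intro x
      by_cases hx : x ∈ U
      · exact b.contDiff.contDiffAt.mul (hN.contDiffAt (hU.mem_nhds hx))
      · have hx' : 1 + r < ‖x‖ := by
          by_contra! h
          exact hx (hsub (by simpa using h))
        have : F =ᶠ[𝓝 x] fun _ => 0 := by
          filter_upwards [(isOpen_lt continuous_const continuous_norm).mem_nhds hx'] with y hy
          simp [hF, hz y (le_of_lt hy)]
        exact contDiffAt_const.congr_of_eventuallyEq this
    · have : b x = 0 := hz x (by linarith [min_le_right δ 1])
      simp [hF, this]
  refine ⟨_, (phi_lim hG).1, fun x hx => ?_⟩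
  have e : F x = N x := by
    have : b x = 1 := b.one_of_mem_closedBall hx
    simp [hF, this]
  rw [← e]; exact (phi_lim hG).2 x hx

end Pol
end

section
open Set Filter Topology MvPolynomial
namespace Pol
variable {m : ℕ}

theorem Cau.qQ (hm : 0 < m) {H : ℕ → Fin m → Pol m} (hH : ∀ l, Cau (fun n => H n l)) (l : Fin m) :
    Cau (fun n => qQ (H n) l) := by
  have h0 : 0 < (m:ℝ) / 2 := by positivity
  have hd : Cau (fun n => ∑ l, pderiv l (H n l)) := Cau.sum _ fun l => (hH l).d l
  have hb : Cau (fun n => bb (H n)) := (hd.tt h0).smul _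
  have hgG : ∀ l, Cau (fun n => gG (H n) l) := fun l => ((hb.d l).tt one_pos).neg
  have hz : ∀ l, Cau (fun n => zZ (H n) l) := fun l => (hH l).add (hgG l).sq_mul
  have hg : Cau (fun n => gg (H n)) := (((hb.smul 2).sub hd).tt h0).smul _
  exact ((hz l).add (hg.sq_mul.d l)).tt one_pos

end Pol
open Pol

theorem ex_Q {m : ℕ} (hm : 2 ≤ m) (N : Fin m → E m → ℝ) (p : Fin m → ℕ → Pol m)
    (hp : ∀ i, Lim (p i) (N i)) :
    ∃ Q : Fin m → E m → ℝ, IsBarPart Q ∧ ∀ x ∈ Sph m, ∀ l,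
      ∑ k, (pd k (Q l) x - pd l (Q k) x) * x k = ∑ k, (pd k (N l) x - pd l (N k) x) * x k := by
  have hm0 : 0 < m := by omega
  set W : ℕ → Fin m → Pol m := fun n l => ∑ k, X k * (pderiv k (p l n) - pderiv l (p k n)) with hWd
  have hWc : ∀ l, Cau (fun n => W n l) := fun l =>
    Cau.sum _ fun k => (((hp l).1.d k).sub ((hp k).1.d l)).X_mul k
  have hW : ∀ n, ∑ l, X l * W n l = 0 := by
    intro n
    simp only [hWd, Finset.mul_sum]
    have e : ∑ l, ∑ k, X l * (X k * (pderiv k (p l n) - pderiv l (p k n))) =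
       - ∑ l, ∑ k, X l * (X k * (pderiv k (p l n) - pderiv l (p k n))) := by
      conv_lhs => rw [Finset.sum_comm]
      rw [← Finset.sum_neg_distrib]
      refine Finset.sum_congr rfl fun k _ => ?_
      rw [← Finset.sum_neg_distrib]
      exact Finset.sum_congr rfl fun l _ => by ring
    exact self_eq_neg.1 e
  set H : ℕ → Fin m → Pol m := fun n l => hP (W n l) with hH
  have hHc : ∀ l, Cau (fun n => H n l) := fun l => (hWc l).hP hm
  have hHl : ∀ n l, lp (H n l) = 0 := fun n l => lp_hP hm0 _
  have hHW : ∀ n l, H n l = W n l - sq * aI (lp (W n l)) := fun n l => rfl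
  choose Q hQ using fun l => (Cau.qQ hm0 hHc l).exists_lim
  have hdd := fun i j => (hQ j).d i
  refine ⟨Q, ⟨fun i => (hQ i).sm, fun x hx => ?_, fun x hx => ?_, fun x hx j k => ?_⟩, fun x hx l => ?_⟩
  · have h1 : Tendsto (fun n => ∑ i, ev (pderiv i (qQ (H n) i)) x) atTop (𝓝 (∑ i, pd i (Q i) x)) :=
      tendsto_finsetSum _ fun i _ => (hdd i i).2 x hx
    refine tendsto_nhds_unique h1 ?_
    simp only [← ev_sum, div_qQ hm0 _ _ _ (hHl _) (hHW _) (hW _) (inj hm0), ev_zero]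
    exact tendsto_const_nhds
  · have h1 : Tendsto (fun n => ∑ k, ev (X k * qQ (H n) k) x) atTop (𝓝 (∑ k, Q k x * x k)) := by
      refine tendsto_finsetSum _ fun k _ => ?_
      simp only [ev_mul, ev_X, mul_comm (x k)]
      exact ((hQ k).2 x (sph_sub hx)).mul_const _
    refine tendsto_nhds_unique h1 ?_
    simp only [← ev_sum, dot_qQ hm0 _ _ _ (hHl _) (hHW _) (hW _) (inj hm0)]
    simp only [ev_mul, ev_sq hx, zero_mul]
    exact tendsto_const_nhds
  · refine tendsto_nhds_unique (((hQ k).lp.d j).2 x hx) ?_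
    simp only [lap_qQ hm0 _ (hHl _) j k]
    exact ((hQ j).lp.d k).2 x hx
  · have hxB := sph_sub hx
    have h1 : Tendsto (fun n => ev (∑ k, (pderiv k (qQ (H n) l) - pderiv l (qQ (H n) k)) * X k) x) atTop
        (𝓝 (∑ k, (pd k (Q l) x - pd l (Q k) x) * x k)) := by
      simp only [ev_sum, ev_mul, ev_sub, ev_X]
      exact tendsto_finsetSum _ fun k _ => (((hdd k l).2 x hxB).sub ((hdd l k).2 x hxB)).mul_const _
    refine tendsto_nhds_unique h1 ?_
    simp only [curl_qQ hm0 _ _ _ (hHl _) (hHW _) (hW _) (inj hm0), ev_add, ev_mul, ev_sq hx, zero_mul, add_zero]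
    simp only [hWd, ev_sum, ev_mul, ev_sub, ev_X, mul_comm (x _)]
    exact tendsto_finsetSum _ fun k _ => ((((hp l).d k).2 x hxB).sub (((hp k).d l).2 x hxB)).mul_const _

end

theorem divergence_free_tangential_decomposition
    (m : ℕ) (hm : 2 ≤ m)
    (N : Fin m → E m → ℝ)
    (hN_smooth : ∃ U : Set (E m), IsOpen U ∧ Ball m ⊆ U ∧
      ∀ i, ContDiffOn ℝ (⊤ : ℕ∞) (N i) U)
    (hN_div : ∀ x ∈ Ball m, ∑ i, pd i (N i) x = 0)
    (hN_tang : ∀ x ∈ Sph m, ∑ k, N k x * x k = 0) :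
    ∃ (P Q : Fin m → E m → ℝ),
      IsNdPart P ∧ IsBarPart Q ∧
      (∀ i, ∀ x ∈ Ball m, N i x = P i x + Q i x) ∧
      -- uniqueness of the decomposition
      (∀ P' Q' : Fin m → E m → ℝ,
        IsNdPart P' → IsBarPart Q' →
        (∀ i, ∀ x ∈ Ball m, N i x = P' i x + Q' i x) →
        (∀ i, ∀ x ∈ Ball m, P' i x = P i x ∧ Q' i x = Q i x)) := by
  obtain ⟨U, hU, hBU, hNU⟩ := hN_smooth
  choose p hp using fun i => Pol.approx hU hBU (hNU i)
  have hNs : ∀ i, Sm (N i) := fun i => (hp i).sm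
  obtain ⟨Q, hQ, hQN⟩ := ex_Q hm N p hp
  have hQs : ∀ i, Sm (Q i) := hQ.1
  have hswap : ∀ (A : Fin m → Fin m → ℝ) (x v : E m),
      ∑ k, ∑ l, A k l * x k * v l = ∑ l, (∑ k, A k l * x k) * v l := by
    intro A x v
    rw [Finset.sum_comm]
    exact Finset.sum_congr rfl fun l _ => by rw [Finset.sum_mul]
  have hP : IsNdPart (fun i x => N i x - Q i x) := by
    refine ⟨fun i => (hNs i).sub (hQs i), fun x hx => ?_, fun x hx => ?_, fun x hx v _ => ?_⟩
    · simp only [pd_sub (hNs _) (hQs _) _ hx, Finset.sum_sub_distrib, hN_div x hx, hQ.2.1 x hx, sub_zero]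
    · simp only [sub_mul, Finset.sum_sub_distrib, hN_tang x hx, hQ.2.2.1 x hx, sub_zero]
    · simp only [pd_sub (hNs _) (hQs _) _ (sph_sub hx)]
      rw [hswap (fun k l => pd k (N l) x - pd k (Q l) x - (pd l (N k) x - pd l (Q k) x))]
      refine Finset.sum_eq_zero fun l _ => ?_
      have : ∑ k, (pd k (N l) x - pd k (Q l) x - (pd l (N k) x - pd l (Q k) x)) * x k =
        ∑ k, (pd k (N l) x - pd l (N k) x) * x k - ∑ k, (pd k (Q l) x - pd l (Q k) x) * x k := by
        rw [← Finset.sum_sub_distrib]; exact Finset.sum_congr rfl fun k _ => by ring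
      rw [this, hQN x hx l, sub_self, zero_mul]
  refine ⟨fun i x => N i x - Q i x, Q, hP, hQ, fun i x _ => by ring, ?_⟩
  intro P' Q' hP' hQ' hdec
  have hPs : ∀ i, Sm (fun x => N i x - Q i x) := hP.1
  have hPs' : ∀ i, Sm (P' i) := hP'.1
  have hQs' : ∀ i, Sm (Q' i) := hQ'.1
  set D : Fin m → E m → ℝ := fun i x => Q i x - Q' i x with hD
  have hDP : ∀ i, ∀ x ∈ Ball m, D i x = P' i x - (N i x - Q i x) := by
    intro i x hx; simp only [hD]; rw [hdec i x hx]; ring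
  have hpD : ∀ i j, ∀ x ∈ Ball m, pd i (D j) x = pd i (P' j) x - pd i (fun x => N j x - Q j x) x := by
    intro i j x hx
    rw [pd_congr (hDP j) i hx, pd_sub (hPs' j) (hPs j) i hx]
  have hD0 := uniq (by omega) (D := D) (fun i => (hQs i).sub (hQs' i))
    (fun x hx => by
      simp only [hD, pd_sub (hQs _) (hQs' _) _ hx, Finset.sum_sub_distrib, hQ.2.1 x hx, hQ'.2.1 x hx, sub_zero])
    (fun x hx => by
      simp only [hD, sub_mul, Finset.sum_sub_distrib, hQ.2.2.1 x hx, hQ'.2.2.1 x hx, sub_zero])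
    (fun x hx v hv => by
      have h1 := hP'.2.2.2 x hx v hv
      have h2 := hP.2.2.2 x hx v hv
      rw [← sub_zero (0:ℝ)]
      nth_rw 1 [← h1]
      rw [← h2]
      rw [← Finset.sum_sub_distrib]
      refine Finset.sum_congr rfl fun k _ => ?_
      rw [← Finset.sum_sub_distrib]
      refine Finset.sum_congr rfl fun l _ => ?_
      rw [hpD _ _ x (sph_sub hx), hpD _ _ x (sph_sub hx)]; ring)
    (fun x hx j k => by
      have e : ∀ j k, pd j (lap (D k)) x = pd j (lap (Q k)) x - pd j (lap (Q' k)) x := by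
        intro j k
        rw [pd_congr (fun y hy => lap_sub (hQs k) (hQs' k) hy) j hx, pd_sub (hQs k).lap (hQs' k).lap j hx]
      rw [e, e, hQ.2.2.2 x hx, hQ'.2.2.2 x hx])
  intro i x hx
  have h1 := hD0 i x hx
  have h2 := hDP i x hx
  simp only [hD] at h1 h2
  constructor <;> linarith

end
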